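/- arXiv:math/0209333 — 2 statements merged into one kernel-verified Lean document; each statement's English description precedes it below -/
import Mathlib

section
/- (Finiteness of the class number) Let L be an even lattice. Then the set of isometry classes of even lattices lying in the same genus as L is finite. -/
open scoped BigOperators

noncomputable section

/-- The group `ℚ/ℤ`. -/
abbrev QmodZ : Type := ℚ ⧸ AddSubgroup.zmultiples (1 : ℚ)

/-- The group `ℚ/2ℤ`. -/
abbrev Qmod2Z : Type := ℚ ⧸ AddSubgroup.zmultiples (2 : ℚ)

/-- The isomorphism `ℚ/2ℤ → ℚ/ℤ` induced by dividing by `2`. -/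
noncomputable def halfHom : Qmod2Z →+ QmodZ :=
  QuotientAddGroup.map _ _ (AddMonoidHom.mk' (fun x : ℚ => x / 2) (fun a b => add_div a b 2))
    (by
      intro x hx
      obtain ⟨k, rfl⟩ := AddSubgroup.mem_zmultiples_iff.mp hx
      refine AddSubgroup.mem_zmultiples_iff.mpr ⟨k, ?_⟩
      show k • (1:ℚ) = (k • (2:ℚ)) / 2
      push_cast [zsmul_eq_mul]
      ring)

/-- The bilinear form `b(x,y) = (q(x+y) - q(x) - q(y))/2 ∈ ℚ/ℤ` associated to
`q : A → ℚ/2ℤ`. -/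
def bForm {A : Type*} [AddCommGroup A] (q : A → Qmod2Z) (x y : A) : QmodZ :=
  halfHom (q (x + y) - q x - q y)

/-- `q : A → ℚ/2ℤ` is a finite quadratic space structure on the finite abelian group `A`
if the associated form `b` is `ℤ`-bilinear (i.e. biadditive) and nondegenerate. -/
structure IsFiniteQuadraticSpace {A : Type*} [AddCommGroup A] [Finite A]
    (q : A → Qmod2Z) : Prop where
  add_left : ∀ x x' y, bForm q (x + x') y = bForm q x y + bForm q x' y
  add_right : ∀ x y y', bForm q x (y + y') = bForm q x y + bForm q x y'
  nondeg : ∀ x, (∀ y, bForm q x y = 0) → x = 0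

/-- Two quadratic forms are isometric if some group isomorphism carries one to the other. -/
def FQSIsometric {A B : Type*} [AddCommGroup A] [AddCommGroup B]
    (qA : A → Qmod2Z) (qB : B → Qmod2Z) : Prop :=
  ∃ e : A ≃+ B, ∀ x, qB (e x) = qA x

/-- An even lattice, given by its rank and Gram matrix: the Gram matrix is symmetric,
has even diagonal (so `(x,x)` is always even) and is nondegenerate. -/
structure EvenLattice : Type where
  n : ℕ
  B : Matrix (Fin n) (Fin n) ℤ
  symm : B.IsSymm
  even_diag : ∀ i, 2 ∣ B i i
  nondeg : B.det ≠ 0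

/-- The bilinear form of `L` extended to `R^n` for any commutative ring `R ⊇ ℤ`. -/
def formR (L : EvenLattice) (R : Type*) [CommRing R] (x y : Fin L.n → R) : R :=
  ∑ i, ∑ j, (L.B i j : R) * x i * y j

theorem formR_zero_left (L : EvenLattice) (R : Type*) [CommRing R] (y : Fin L.n → R) :
    formR L R 0 y = 0 := by
  simp [formR]

theorem formR_add_left (L : EvenLattice) (R : Type*) [CommRing R] (x x' y : Fin L.n → R) :
    formR L R (x + x') y = formR L R x y + formR L R x' y := by
  simp [formR, mul_add, add_mul, Finset.sum_add_distrib]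

theorem formR_neg_left (L : EvenLattice) (R : Type*) [CommRing R] (x y : Fin L.n → R) :
    formR L R (-x) y = -formR L R x y := by
  simp [formR, Finset.sum_neg_distrib]

/-- `L` and `M` are isometric over `R`. -/
def IsometricOver (R : Type*) [CommRing R] (L M : EvenLattice) : Prop :=
  ∃ e : (Fin L.n → R) ≃ₗ[R] (Fin M.n → R), ∀ x y, formR M R (e x) (e y) = formR L R x y

/-- `L` and `M` lie in the same genus: they are isometric over `ℤ_p` for all primes `p`
and over `ℝ`. -/
def SameGenus (L M : EvenLattice) : Prop :=
  (∀ (p : ℕ) [Fact p.Prime], IsometricOver ℤ_[p] L M) ∧ IsometricOver ℝ L M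

/-- The subgroup of integral vectors in `ℚ^n`, i.e. the lattice `L` itself inside `L ⊗ ℚ`. -/
def intSub (L : EvenLattice) : AddSubgroup (Fin L.n → ℚ) where
  carrier := {x | ∀ i, ∃ m : ℤ, x i = m}
  zero_mem' := fun i => ⟨0, by simp⟩
  add_mem' := by
    intro x y hx hy i
    obtain ⟨mx, hmx⟩ := hx i
    obtain ⟨my, hmy⟩ := hy i
    exact ⟨mx + my, by simp [hmx, hmy]⟩
  neg_mem' := by
    intro x hx i
    obtain ⟨m, hm⟩ := hx i
    exact ⟨-m, by simp [hm]⟩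

/-- The dual lattice of a subgroup `K` of `L ⊗ ℚ`:
all vectors pairing integrally with every element of `K`. -/
def dualOf (L : EvenLattice) (K : AddSubgroup (Fin L.n → ℚ)) : AddSubgroup (Fin L.n → ℚ) where
  carrier := {x | ∀ y ∈ K, ∃ m : ℤ, formR L ℚ x y = m}
  zero_mem' := fun y _ => ⟨0, by simp [formR_zero_left]⟩
  add_mem' := by
    intro x x' hx hx' y hy
    obtain ⟨m, hm⟩ := hx y hy
    obtain ⟨m', hm'⟩ := hx' y hy
    exact ⟨m + m', by rw [formR_add_left, hm, hm']; push_cast; ring⟩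
  neg_mem' := by
    intro x hx y hy
    obtain ⟨m, hm⟩ := hx y hy
    exact ⟨-m, by rw [formR_neg_left, hm]; push_cast; ring⟩

/-- The dual lattice `L^*` of `L`. -/
abbrev dualSub (L : EvenLattice) : AddSubgroup (Fin L.n → ℚ) := dualOf L (intSub L)

/-- The discriminant group `K^*/K` of a subgroup `K` of `L ⊗ ℚ`. -/
abbrev discGroupOf (L : EvenLattice) (K : AddSubgroup (Fin L.n → ℚ)) : Type :=
  dualOf L K ⧸ K.addSubgroupOf (dualOf L K)

/-- The discriminant group `L^*/L`. -/
abbrev discGroup (L : EvenLattice) : Type := discGroupOf L (intSub L)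

/-- The discriminant form on `K^*/K`, `q(x + K) = (x,x) mod 2ℤ`
(defined via a choice of representative; it is independent of this choice). -/
noncomputable def discQOf (L : EvenLattice) (K : AddSubgroup (Fin L.n → ℚ)) :
    discGroupOf L K → Qmod2Z :=
  fun a => (QuotientAddGroup.mk (formR L ℚ (a.out : Fin L.n → ℚ) (a.out : Fin L.n → ℚ)) : Qmod2Z)

/-- The discriminant form `q_L` on `L^*/L`. -/
noncomputable def discQ (L : EvenLattice) : discGroup L → Qmod2Z := discQOf L (intSub L)

/-- `n₊`: the maximal dimension of a positive definite subspace of `L ⊗ ℝ`. -/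
noncomputable def sigPlus (L : EvenLattice) : ℕ :=
  sSup {d : ℕ | ∃ W : Submodule ℝ (Fin L.n → ℝ), Module.finrank ℝ W = d ∧
    ∀ x ∈ W, x ≠ 0 → 0 < formR L ℝ x x}

/-- `n₋`: the maximal dimension of a negative definite subspace of `L ⊗ ℝ`. -/
noncomputable def sigMinus (L : EvenLattice) : ℕ :=
  sSup {d : ℕ | ∃ W : Submodule ℝ (Fin L.n → ℝ), Module.finrank ℝ W = d ∧
    ∀ x ∈ W, x ≠ 0 → formR L ℝ x x < 0}

end

open Matrix

theorem mem_bez {n : ℕ} (v : Fin n → ℤ) (hv : v ≠ 0) :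
    ∃ (g : ℤ) (v1 u : Fin n → ℤ), g ≠ 0 ∧ v = g • v1 ∧ u ⬝ᵥ v1 = 1 := by
  let I : Ideal ℤ := Ideal.span (Set.range v)
  obtain ⟨g, hg⟩ := (IsPrincipalIdealRing.principal I).principal
  have hg' : g ∈ I := by rw [hg]; exact Submodule.mem_span_singleton_self g
  obtain ⟨u, hu⟩ := Ideal.mem_span_range_iff_exists_fun.mp hg'
  have hd : ∀ i, ∃ c, v i = g * c := by
    intro i
    have : v i ∈ I := Ideal.subset_span ⟨i, rfl⟩
    rw [hg] at this
    obtain ⟨c, hc⟩ := Submodule.mem_span_singleton.mp this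
    exact ⟨c, by rw [← hc]; simp [mul_comm]⟩
  choose v1 hv1 using hd
  have hg0 : g ≠ 0 := by
    rintro rfl
    apply hv; ext i; simp [hv1]
  refine ⟨g, v1, u, hg0, by ext i; simp [hv1], ?_⟩
  apply mul_left_cancel₀ hg0
  rw [mul_one, dotProduct, Finset.mul_sum]
  conv_rhs => rw [← hu]
  refine Finset.sum_congr rfl fun i _ => by rw [hv1]; ring

theorem finish_lemma {n : ℕ} (F : Set (Matrix (Fin n) (Fin n) ℤ)) (hF : F.Finite) (N : ℕ) (hN : N ≠ 0) :
    ∃ S : Set (Matrix (Fin n) (Fin n) ℤ), S.Finite ∧ ∀ A T Q : Matrix (Fin n) (Fin n) ℤ,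
      T * Q = (N : ℤ) • 1 → Tᵀ * A * T ∈ F →
      ∃ U U' : Matrix (Fin n) (Fin n) ℤ, U * U' = 1 ∧ Uᵀ * A * U ∈ S := by
  classical
  have : NeZero N := ⟨hN⟩
  have := hF.to_subtype
  let R : F × Matrix (Fin n) (Fin n) (ZMod N) → Matrix (Fin n) (Fin n) ℤ → Prop := fun x A =>
    ∃ T Q : Matrix (Fin n) (Fin n) ℤ, T * Q = (N : ℤ) • 1 ∧ Tᵀ * A * T = x.1 ∧
      T.map (Int.cast : ℤ → ZMod N) = x.2
  let f : F × Matrix (Fin n) (Fin n) (ZMod N) → Matrix (Fin n) (Fin n) ℤ := fun x =>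
    if h : ∃ A, R x A then h.choose else 0
  refine ⟨Set.range f, Set.finite_range f, ?_⟩
  intro A T Q hTQ hT
  have hR : R (⟨_, hT⟩, T.map (Int.cast : ℤ → ZMod N)) A := ⟨T, Q, hTQ, rfl, rfl⟩
  set x : F × Matrix (Fin n) (Fin n) (ZMod N) := (⟨_, hT⟩, T.map (Int.cast : ℤ → ZMod N)) with hx
  have hex : ∃ A, R x A := ⟨A, hR⟩
  obtain ⟨T', Q', h1, h2, h3⟩ := hex.choose_spec
  have hf : f x = hex.choose := by simp only [f]; rw [dif_pos hex]
  rw [← hf] at h2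
  have hN' : (N : ℤ) ≠ 0 := by exact_mod_cast hN
  have comm : ∀ T Q : Matrix (Fin n) (Fin n) ℤ, T * Q = (N : ℤ) • 1 → T.det ≠ 0 ∧ Q * T = (N : ℤ) • 1 := by
    intro T Q h
    have hd : T.det ≠ 0 := by
      intro h0
      have := congrArg Matrix.det h
      rw [Matrix.det_mul, h0, zero_mul, Matrix.det_smul, Matrix.det_one, mul_one] at this
      exact pow_ne_zero _ hN' this.symm
    refine ⟨hd, ?_⟩
    have : T * (Q * T) = T * ((N : ℤ) • 1) := by
      rw [← Matrix.mul_assoc, h, Matrix.smul_mul, Matrix.one_mul, Matrix.mul_smul, Matrix.mul_one]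
    have h4 := congrArg (fun X => T.adjugate * X) this
    simp only [← Matrix.mul_assoc, Matrix.adjugate_mul] at h4
    rw [Matrix.mul_assoc, Matrix.smul_mul, Matrix.one_mul, Matrix.smul_mul, Matrix.one_mul] at h4
    exact smul_right_injective _ hd h4
  obtain ⟨hd, hQT⟩ := comm T Q hTQ
  obtain ⟨hd', hQT'⟩ := comm T' Q' h1
  have hX : ∃ X : Matrix (Fin n) (Fin n) ℤ, T' = T + (N : ℤ) • X := by
    have : ∀ i j, ∃ c, T' i j = T i j + N * c := by
      intro i j
      have := congrFun (congrFun h3 i) j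
      simp only [hx, Matrix.map_apply] at this
      have := (ZMod.intCast_eq_intCast_iff_dvd_sub _ _ N).mp this.symm
      obtain ⟨c, hc⟩ := this
      exact ⟨c, by linarith⟩
    choose X hX using this
    exact ⟨X, by ext i j; exact hX i j⟩
  obtain ⟨X, hX⟩ := hX
  have e1 : (1 + X * Q) * T = T' := by
    rw [Matrix.add_mul, Matrix.mul_assoc, hQT, hX, Matrix.mul_smul, Matrix.mul_one, Matrix.one_mul]
  have e2 : (1 - X * Q') * T' = T := by
    rw [Matrix.sub_mul, Matrix.mul_assoc, hQT', hX, Matrix.mul_smul, Matrix.mul_one, Matrix.one_mul, add_sub_cancel_right]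
  have canc : ∀ T X Y : Matrix (Fin n) (Fin n) ℤ, T.det ≠ 0 → X * T = Y * T → X = Y := by
    intro T X Y hd h
    have h4 := congrArg (fun X => X * T.adjugate) h
    simp only [Matrix.mul_assoc, Matrix.mul_adjugate] at h4
    simp only [Matrix.mul_smul, Matrix.mul_one] at h4
    exact smul_right_injective _ hd h4
  refine ⟨1 - X * Q', 1 + X * Q, ?_, x, ?_⟩
  · apply canc T _ _ hd
    rw [Matrix.mul_assoc, e1, e2, Matrix.one_mul]
  · have hh : T'ᵀ * f x * T' = T'ᵀ * ((1 - X * Q')ᵀ * A * (1 - X * Q')) * T' := by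
      rw [h2]
      show Tᵀ * A * T = _
      conv_lhs => rw [← e2]
      simp only [Matrix.transpose_mul, Matrix.mul_assoc]
    have hh := canc _ _ _ hd' hh
    have hh := congrArg Matrix.transpose hh
    rw [Matrix.transpose_mul, Matrix.transpose_mul] at hh
    simp only [Matrix.transpose_transpose] at hh
    exact Matrix.transpose_injective (canc _ _ _ hd' hh)

theorem split_lemma {n k : ℕ} (A : Matrix (Fin n) (Fin n) ℤ) (V : Matrix (Fin n) (Fin k) ℤ)
    (hG : (Vᵀ * A * V).det ≠ 0) :
    ∃ (m : ℕ) (W : Matrix (Fin n) (Fin m) ℤ) (Q : Matrix (Fin k ⊕ Fin m) (Fin n) ℤ),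
      k + m = n ∧ Vᵀ * A * W = 0 ∧ Matrix.fromCols V W * Q = (Vᵀ * A * V).det • 1 := by
  classical
  let f : (Fin n → ℤ) →ₗ[ℤ] (Fin k → ℤ) := Matrix.toLin' (Vᵀ * A)
  set G := Vᵀ * A * V with hGdef
  have hrange : Module.finrank ℤ (LinearMap.range f) = k := by
    apply le_antisymm
    · simpa using Submodule.finrank_le (LinearMap.range f)
    · let g : (Fin k → ℤ) →ₗ[ℤ] LinearMap.range f :=
        f.rangeRestrict ∘ₗ Matrix.toLin' (V * G.adjugate)
      have hg : Function.Injective g := by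
        intro x y hxy
        have h1 := congrArg Subtype.val hxy
        simp only [g, f, LinearMap.comp_apply, LinearMap.codRestrict_apply, LinearMap.rangeRestrict, Matrix.toLin'_apply,
          Matrix.mulVec_mulVec] at h1
        rw [← Matrix.mul_assoc, ← hGdef, Matrix.mul_adjugate] at h1
        simp only [Matrix.smul_mulVec, Matrix.one_mulVec] at h1
        exact smul_right_injective _ hG h1
      simpa using LinearMap.finrank_le_finrank_of_injective hg
  have hrk := Submodule.finrank_quotient_add_finrank (LinearMap.ker f)
  rw [f.quotKerEquivRange.finrank_eq, hrange] at hrk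
  simp only [Module.finrank_pi, Fintype.card_fin] at hrk
  let b := Module.finBasis ℤ (LinearMap.ker f)
  let P : Matrix (Fin n) (Fin n) ℤ := G.det • 1 - V * G.adjugate * (Vᵀ * A)
  have hP : ∀ j, (fun i => P i j) ∈ LinearMap.ker f := by
    intro j
    have h0 : (Vᵀ * A) * P = 0 := by
      simp only [P, Matrix.mul_sub, Matrix.mul_smul, Matrix.mul_one]
      rw [Matrix.mul_assoc V, ← Matrix.mul_assoc (Vᵀ * A) V, ← hGdef, ← Matrix.mul_assoc, Matrix.mul_adjugate,
        Matrix.smul_mul, Matrix.one_mul, sub_self]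
    rw [LinearMap.mem_ker]
    ext i
    exact congrFun (congrFun h0 i) j
  let W : Matrix (Fin n) (Fin (Module.finrank ℤ (LinearMap.ker f))) ℤ := fun i j => (b j : Fin n → ℤ) i
  let Q2 : Matrix (Fin (Module.finrank ℤ (LinearMap.ker f))) (Fin n) ℤ := fun i j => b.repr ⟨_, hP j⟩ i
  refine ⟨_, W, Matrix.fromRows (G.adjugate * (Vᵀ * A)) Q2, hrk, ?_, ?_⟩
  · ext i j
    have := (b j).2
    rw [LinearMap.mem_ker] at this
    exact congrFun this i
  · rw [Matrix.fromCols_mul_fromRows]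
    have : W * Q2 = P := by
      ext i j
      have h := b.sum_repr ⟨_, hP j⟩
      have h := congrFun (congrArg Subtype.val h) i
      simp only [Submodule.coe_sum, Submodule.coe_smul, Finset.sum_apply, Pi.smul_apply, smul_eq_mul] at h
      rw [Matrix.mul_apply, ← h]
      exact Finset.sum_congr rfl fun x _ => mul_comm _ _
    rw [this]
    simp only [P, Matrix.mul_assoc]
    abel

theorem mink_lemma {n : ℕ} (hn : 0 < n) (D : ℕ) (A : Matrix (Fin n) (Fin n) ℤ) (hs : A.IsSymm)
    (hd : A.det ≠ 0) (hD : |A.det| ≤ D) :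
    ∃ v : Fin n → ℤ, v ≠ 0 ∧ |v ⬝ᵥ (A *ᵥ v)| ≤ n * ((D : ℤ) + 1) ^ 2 := by
  classical
  let AR : Matrix (Fin n) (Fin n) ℝ := A.map (Int.cast : ℤ → ℝ)
  have hdet : AR.det = (A.det : ℝ) := by
    simpa using (Int.cast_det (R := ℝ) A).symm
  have hH : AR.IsHermitian := by
    ext i j
    simp only [AR, Matrix.conjTranspose_apply, Matrix.map_apply, star_trivial]
    rw [hs.apply]
  let U : Matrix (Fin n) (Fin n) ℝ := hH.eigenvectorUnitary
  have hspec : AR = U * diagonal hH.eigenvalues * Uᵀ := by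
    have := hH.spectral_theorem
    rw [Unitary.conjStarAlgAut_apply] at this
    simpa [U, Matrix.star_eq_conjTranspose, Function.comp_def] using this
  have hU : U * Uᵀ = 1 := by
    have := Unitary.mul_star_self_of_mem hH.eigenvectorUnitary.2
    simpa [U, Matrix.star_eq_conjTranspose] using this
  let μ := hH.eigenvalues
  let T : Matrix (Fin n) (Fin n) ℝ := diagonal (fun i => Real.sqrt |μ i|) * Uᵀ
  have hTdet : T.det ^ 2 = |(A.det : ℝ)| := by
    have h1 : U.det ^ 2 = 1 := by
      have := congrArg Matrix.det hU
      rw [Matrix.det_mul, Matrix.det_transpose, Matrix.det_one] at this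
      rw [sq, this]
    have h2 : AR.det = ∏ i, μ i := by simpa using hH.det_eq_prod_eigenvalues
    rw [← hdet, h2, Finset.abs_prod, Matrix.det_mul, Matrix.det_transpose, mul_pow, h1, mul_one,
      Matrix.det_diagonal, ← Finset.prod_pow]
    exact Finset.prod_congr rfl fun i _ => Real.sq_sqrt (abs_nonneg _)
  have hd' : (1 : ℝ) ≤ |(A.det : ℝ)| := by exact_mod_cast Int.one_le_abs hd
  have hT0 : T.det ≠ 0 := by
    intro h; rw [h] at hTdet; rw [← hTdet] at hd'; norm_num at hd'
  have hli : LinearIndependent ℝ (Tᵀ).row := by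
    rw [Matrix.linearIndependent_rows_iff_isUnit, Matrix.isUnit_iff_isUnit_det, Matrix.det_transpose]
    exact isUnit_iff_ne_zero.mpr hT0
  have : Nonempty (Fin n) := ⟨⟨0, hn⟩⟩
  let b := basisOfLinearIndependentOfCardEqFinrank hli (by simp)
  have hb : ∀ j i, b j i = T i j := by
    intro j i; simp only [b]; rw [coe_basisOfLinearIndependentOfCardEqFinrank]; rfl
  let r : ℝ := (D : ℝ) + 1
  have hr : 0 < r := by positivity
  let s : Set (Fin n → ℝ) := Metric.ball 0 r
  have hvol : MeasureTheory.volume s = ENNReal.ofReal ((2 * r) ^ n) := by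
    simp only [s]; rw [Real.volume_pi_ball _ hr]; simp
  have hfund := ZSpan.isAddFundamentalDomain b MeasureTheory.volume
  have hTle : |T.det| ≤ D := by
    have hD' : |(A.det : ℝ)| ≤ D := by exact_mod_cast hD
    apply abs_le_of_sq_le_sq (h := ?_) (hb := by positivity)
    rw [hTdet]; nlinarith
  have hlt : MeasureTheory.volume (ZSpan.fundamentalDomain b) * 2 ^ Module.finrank ℝ (Fin n → ℝ) <
      MeasureTheory.volume s := by
    rw [hvol, ZSpan.volume_fundamentalDomain]
    have : (Matrix.of b).det = T.det := by
      rw [← Matrix.det_transpose T]; congr 1; ext i j; simp [hb]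
    rw [this]
    have e2 : (2 : ENNReal) ^ Module.finrank ℝ (Fin n → ℝ) = ENNReal.ofReal (2 ^ n) := by
      rw [ENNReal.ofReal_pow (by norm_num)]; simp
    rw [e2, ← ENNReal.ofReal_mul (abs_nonneg _), ENNReal.ofReal_lt_ofReal_iff (by positivity), mul_pow,
      mul_comm]
    apply mul_lt_mul_of_pos_left _ (by positivity)
    have : r ^ 1 ≤ r ^ n := pow_le_pow_right₀ (by simp [r]) hn
    simp only [r] at *
    linarith
  have : Countable (Submodule.span ℤ (Set.range b)).toAddSubgroup :=
    inferInstanceAs (Countable (Submodule.span ℤ (Set.range b)))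
  obtain ⟨x, hx0, hxs⟩ := MeasureTheory.exists_ne_zero_mem_lattice_of_measure_mul_two_pow_lt_measure
    (L := (Submodule.span ℤ (Set.range b)).toAddSubgroup) hfund
    (s := s) (fun x hx => by simpa [s] using hx) (convex_ball 0 r) hlt
  have hxm : (x : Fin n → ℝ) ∈ Submodule.span ℤ (Set.range b) := x.2
  obtain ⟨v, hv⟩ := (Submodule.mem_span_range_iff_exists_fun ℤ).mp hxm
  have hxv : (x : Fin n → ℝ) = T *ᵥ (fun i => (v i : ℝ)) := by
    rw [← hv]; ext i
    simp [Matrix.mulVec, dotProduct, hb, mul_comm]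
  refine ⟨v, ?_, ?_⟩
  · rintro rfl
    apply hx0; ext i; rw [hxv]; simp [Matrix.mulVec, dotProduct]
  · let vr : Fin n → ℝ := fun i => v i
    have key : ((v ⬝ᵥ (A *ᵥ v) : ℤ) : ℝ) = ∑ i, μ i * ((Uᵀ *ᵥ vr) i) ^ 2 := by
      have : ((v ⬝ᵥ (A *ᵥ v) : ℤ) : ℝ) = vr ⬝ᵥ (AR *ᵥ vr) := by
        simp [dotProduct, Matrix.mulVec, vr, AR]
      rw [this, hspec, ← Matrix.mulVec_mulVec, ← Matrix.mulVec_mulVec, Matrix.dotProduct_mulVec,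
        ← Matrix.mulVec_transpose]
      simp only [dotProduct, Matrix.mulVec_diagonal]
      exact Finset.sum_congr rfl fun i _ => by simp only [μ]; ring
    have hbd : ∀ i, |μ i * ((Uᵀ *ᵥ vr) i) ^ 2| ≤ r ^ 2 := by
      intro i
      have h1 : (x : Fin n → ℝ) i = Real.sqrt |μ i| * (Uᵀ *ᵥ vr) i := by
        rw [hxv]; simp only [T]; rw [← Matrix.mulVec_mulVec, Matrix.mulVec_diagonal]
      have h2 : |(x : Fin n → ℝ) i| ≤ r := by
        have h3 : ‖(x : Fin n → ℝ)‖ < r := by simpa [s] using hxs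
        exact (norm_le_pi_norm (x : Fin n → ℝ) i).trans h3.le
      have h4 : |μ i * ((Uᵀ *ᵥ vr) i) ^ 2| = ((x : Fin n → ℝ) i) ^ 2 := by
        rw [h1, mul_pow, Real.sq_sqrt (abs_nonneg _), abs_mul, abs_of_nonneg (sq_nonneg ((Uᵀ *ᵥ vr) i))]
      rw [h4]; exact sq_le_sq' (by linarith [abs_le.mp h2]) (abs_le.mp h2).2
    have : |((v ⬝ᵥ (A *ᵥ v) : ℤ) : ℝ)| ≤ n * ((D : ℝ) + 1) ^ 2 := by
      rw [key]
      refine (Finset.abs_sum_le_sum_abs _ _).trans ((Finset.sum_le_sum fun i _ => hbd i).trans ?_)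
      simp [r]
    exact_mod_cast this

theorem key_lemma {n : ℕ} (hn : 0 < n) (D : ℕ) (A : Matrix (Fin n) (Fin n) ℤ) (hs : A.IsSymm)
    (hd : A.det ≠ 0) (hD : |A.det| ≤ D) :
    ∃ (k : ℕ) (V : Matrix (Fin n) (Fin k) ℤ), 1 ≤ k ∧ k ≤ 2 ∧ (Vᵀ * A * V).det ≠ 0 ∧
      ∀ i j, |(Vᵀ * A * V) i j| ≤ n * ((D : ℤ) + 1) ^ 2 + 2 * D := by
  obtain ⟨v, hv0, hv⟩ := mink_lemma hn D A hs hd hD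
  have ent : ∀ {k : ℕ} (V : Matrix (Fin n) (Fin k) ℤ) i j,
      (Vᵀ * A * V) i j = (fun a => V a i) ⬝ᵥ (A *ᵥ (fun a => V a j)) := by
    intro k V i j
    rw [Matrix.mul_assoc]
    rfl
  by_cases h0 : v ⬝ᵥ (A *ᵥ v) = 0
  · obtain ⟨g, v1, u, hg, hvg, hu⟩ := mem_bez v hv0
    have h1 : v1 ⬝ᵥ (A *ᵥ v1) = 0 := by
      rw [hvg, Matrix.mulVec_smul, smul_dotProduct, dotProduct_smul] at h0
      simpa [hg] using h0
    let w' : Fin n → ℤ := A.adjugateᵀ *ᵥ u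
    have hw' : w' ⬝ᵥ (A *ᵥ v1) = A.det := by
      simp only [w']
      rw [Matrix.mulVec_transpose, ← Matrix.dotProduct_mulVec, Matrix.mulVec_mulVec,
        Matrix.adjugate_mul, Matrix.smul_mulVec, Matrix.one_mulVec, dotProduct_smul, hu]
      simp
    have sym : ∀ x y, x ⬝ᵥ (A *ᵥ y) = y ⬝ᵥ (A *ᵥ x) := by
      intro x y
      rw [Matrix.dotProduct_mulVec, ← Matrix.mulVec_transpose, hs, dotProduct_comm]
    let t : ℤ := (w' ⬝ᵥ (A *ᵥ w')) / (2 * A.det)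
    let w : Fin n → ℤ := w' - t • v1
    have hwv : w ⬝ᵥ (A *ᵥ v1) = A.det := by
      simp only [w]
      rw [sub_dotProduct, smul_dotProduct, h1, hw']; simp
    have hvw : v1 ⬝ᵥ (A *ᵥ w) = A.det := by rw [sym, hwv]
    have hww : w ⬝ᵥ (A *ᵥ w) = (w' ⬝ᵥ (A *ᵥ w')) % (2 * A.det) := by
      have : w ⬝ᵥ (A *ᵥ w) = w' ⬝ᵥ (A *ᵥ w') - 2 * A.det * t := by
        conv_lhs => rw [show w = w' - t • v1 from rfl]
        rw [Matrix.mulVec_sub, Matrix.mulVec_smul]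
        simp only [sub_dotProduct, dotProduct_sub, smul_dotProduct, dotProduct_smul, smul_eq_mul]
        rw [h1, hw', sym v1 w', hw']; ring
      rw [this, Int.emod_def]
    have hd2 : 2 * A.det ≠ 0 := by simpa using hd
    have hwwb : |w ⬝ᵥ (A *ᵥ w)| ≤ 2 * D := by
      rw [hww, abs_of_nonneg (Int.emod_nonneg _ hd2)]
      have := Int.emod_lt_abs (w' ⬝ᵥ (A *ᵥ w')) hd2
      rw [abs_mul] at this; norm_num at this; linarith
    let V : Matrix (Fin n) (Fin 2) ℤ := fun a i => ![v1 a, w a] i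
    have e00 : (Vᵀ * A * V) 0 0 = 0 := by rw [ent]; exact h1
    have e01 : (Vᵀ * A * V) 0 1 = A.det := by rw [ent]; exact hvw
    have e10 : (Vᵀ * A * V) 1 0 = A.det := by rw [ent]; exact hwv
    have e11 : |(Vᵀ * A * V) 1 1| ≤ 2 * D := by rw [ent]; exact hwwb
    have hpos : (0 : ℤ) ≤ n * ((D : ℤ) + 1) ^ 2 := by positivity
    refine ⟨2, V, by norm_num, le_rfl, ?_, ?_⟩
    · rw [Matrix.det_fin_two, e00, e01, e10]
      simpa using hd
    · intro i j
      fin_cases i <;> fin_cases j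
      · show |(Vᵀ * A * V) 0 0| ≤ _
        rw [e00, abs_zero]; positivity
      · show |(Vᵀ * A * V) 0 1| ≤ _
        rw [e01]; linarith
      · show |(Vᵀ * A * V) 1 0| ≤ _
        rw [e10]; linarith
      · show |(Vᵀ * A * V) 1 1| ≤ _
        linarith
  · let V : Matrix (Fin n) (Fin 1) ℤ := fun a _ => v a
    refine ⟨1, V, le_rfl, by norm_num, ?_, ?_⟩
    · rw [Matrix.det_fin_one, ent]; exact h0
    · intro i j
      rw [ent]
      refine hv.trans ?_
      have : (0 : ℤ) ≤ D := by positivity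
      linarith

theorem finite_bdd (k : ℕ) (C : ℤ) :
    {G : Matrix (Fin k) (Fin k) ℤ | ∀ i j, |G i j| ≤ C}.Finite := by
  have : {G : Fin k → Fin k → ℤ | ∀ i, G i ∈ {r : Fin k → ℤ | ∀ j, r j ∈ Set.Icc (-C) C}}.Finite :=
    Set.Finite.pi' fun i => Set.Finite.pi' fun j => Set.finite_Icc _ _
  refine this.subset ?_
  intro G hG i j
  exact ⟨(abs_le.mp (hG i j)).1, (abs_le.mp (hG i j)).2⟩

theorem det_bdd (k : ℕ) (C : ℤ) : ∃ B : ℕ, ∀ G : Matrix (Fin k) (Fin k) ℤ,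
    (∀ i j, |G i j| ≤ C) → |G.det| ≤ B := by
  obtain ⟨B, hB⟩ := ((finite_bdd k C).image (fun G => |G.det|)).bddAbove
  refine ⟨B.toNat, fun G hG => (hB ⟨G, hG, rfl⟩).trans (Int.self_le_toNat B)⟩

theorem finite_classes (n : ℕ) : ∀ D : ℕ,
    ∃ S : Set (Matrix (Fin n) (Fin n) ℤ), S.Finite ∧ ∀ A : Matrix (Fin n) (Fin n) ℤ, A.IsSymm →
      A.det ≠ 0 → |A.det| ≤ D →
      ∃ U U' : Matrix (Fin n) (Fin n) ℤ, U * U' = 1 ∧ Uᵀ * A * U ∈ S := by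
  classical
  induction n using Nat.strong_induction_on with
  | _ n ih =>
  intro D
  rcases Nat.eq_zero_or_pos n with rfl | hn
  · exact ⟨Set.univ, Set.toFinite _, fun A _ _ _ => ⟨1, 1, by simp, trivial⟩⟩
  let C : ℤ := n * ((D : ℤ) + 1) ^ 2 + 2 * D
  obtain ⟨B1, hB1⟩ := det_bdd 1 C
  obtain ⟨B2, hB2⟩ := det_bdd 2 C
  let B := B1 + B2
  let D' : ℕ := (B ^ n) ^ 2 * D
  have ih' : ∀ m : Fin n, ∃ S : Set (Matrix (Fin m) (Fin m) ℤ), S.Finite ∧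
      ∀ A : Matrix (Fin m) (Fin m) ℤ, A.IsSymm → A.det ≠ 0 → |A.det| ≤ D' →
      ∃ U U' : Matrix (Fin m) (Fin m) ℤ, U * U' = 1 ∧ Uᵀ * A * U ∈ S := fun m => ih m m.2 D'
  choose S hSf hS using ih'
  let F : Set (Matrix (Fin n) (Fin n) ℤ) := ⋃ m : Fin n, ⋃ k : Fin 3, ⋃ e : Fin n ≃ Fin k ⊕ Fin m,
    (fun p : Matrix (Fin k) (Fin k) ℤ × Matrix (Fin m) (Fin m) ℤ =>
      (Matrix.fromBlocks p.1 0 0 p.2).submatrix e e) '' ({G | ∀ i j, |G i j| ≤ C} ×ˢ S m)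
  have hF : F.Finite := Set.finite_iUnion fun m => Set.finite_iUnion fun k => Set.finite_iUnion fun e =>
    ((finite_bdd _ C).prod (hSf m)).image _
  obtain ⟨S', hS'f, hS'⟩ := finish_lemma F hF (B.factorial) (Nat.factorial_ne_zero _)
  refine ⟨S', hS'f, ?_⟩
  intro A hs hd hD
  obtain ⟨k, V, hk1, hk2, hG, hGC⟩ := key_lemma hn D A hs hd hD
  obtain ⟨m, W, Q, hkm, hVW, hQ⟩ := split_lemma A V hG
  set G := Vᵀ * A * V with hGdef
  have hNB : |G.det| ≤ B := by
    have : k = 1 ∨ k = 2 := by omega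
    rcases this with rfl | rfl
    · refine (hB1 G hGC).trans ?_
      simp [B]
    · refine (hB2 G hGC).trans ?_
      simp [B]
  have hm : m < n := by omega
  let e : Fin n ≃ Fin k ⊕ Fin m := (finCongr hkm.symm).trans finSumFinEquiv.symm
  have hWV : Wᵀ * A * V = 0 := by
    have := congrArg Matrix.transpose hVW
    simpa [Matrix.transpose_mul, hs.eq, Matrix.mul_assoc] using this
  let A' := Wᵀ * A * W
  have hblk : ∀ U : Matrix (Fin m) (Fin m) ℤ, (Matrix.fromCols V (W * U))ᵀ * A * Matrix.fromCols V (W * U)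
      = Matrix.fromBlocks G 0 0 (Uᵀ * A' * U) := by
    intro U
    rw [Matrix.transpose_fromCols, Matrix.fromRows_mul, Matrix.fromRows_mul_fromCols]
    congr 1
    · rw [← Matrix.mul_assoc, hVW, Matrix.zero_mul]
    · rw [Matrix.transpose_mul, Matrix.mul_assoc, Matrix.mul_assoc, ← Matrix.mul_assoc Wᵀ, hWV, Matrix.mul_zero]
    · simp only [A', Matrix.transpose_mul, Matrix.mul_assoc]
  have hsub : ∀ T : Matrix (Fin n) (Fin k ⊕ Fin m) ℤ,
      (T.submatrix id e)ᵀ * A * T.submatrix id e = (Tᵀ * A * T).submatrix e e := by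
    intro T
    ext i j
    simp [Matrix.mul_apply]
  have hsub2 : ∀ (T : Matrix (Fin n) (Fin k ⊕ Fin m) ℤ) (Q : Matrix (Fin k ⊕ Fin m) (Fin n) ℤ),
      T.submatrix id e * Q.submatrix e id = T * Q := by
    intro T Q
    rw [Matrix.submatrix_mul_equiv]; rfl
  have hA's : A'.IsSymm := by
    simp only [A', Matrix.IsSymm, Matrix.transpose_mul, Matrix.transpose_transpose, hs.eq, Matrix.mul_assoc]
  let T0 := (Matrix.fromCols V W).submatrix id e
  have hT0Q : T0 * Q.submatrix e id = G.det • 1 := by rw [hsub2, hQ]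
  have hdetT : T0.det * (Q.submatrix e id).det = G.det ^ n := by
    rw [← Matrix.det_mul, hT0Q, Matrix.det_smul]; simp
  have hTd0 : T0.det ≠ 0 := by
    intro h; rw [h, zero_mul] at hdetT; exact pow_ne_zero _ hG hdetT.symm
  have hTdB : |T0.det| ≤ (B : ℤ) ^ n := by
    have h1 : T0.det ∣ G.det ^ n := ⟨_, hdetT.symm⟩
    have h2 := Int.le_of_dvd (abs_pos.mpr (pow_ne_zero n hG)) ((abs_dvd_abs _ _).mpr h1)
    rw [abs_pow] at h2
    exact h2.trans (pow_le_pow_left₀ (abs_nonneg _) hNB n)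
  have hdetA' : T0.det ^ 2 * A.det = G.det * A'.det := by
    have h1 : T0ᵀ * A * T0 = (Matrix.fromBlocks G 0 0 A').submatrix e e := by
      have := hblk 1
      simp only [Matrix.mul_one, Matrix.transpose_one, Matrix.one_mul] at this
      rw [← this, ← hsub]
    have h2 := congrArg Matrix.det h1
    rw [Matrix.det_submatrix_equiv_self, Matrix.det_fromBlocks_zero₂₁, Matrix.det_mul, Matrix.det_mul,
      Matrix.det_transpose] at h2
    rw [← h2]; ring
  have hA'0 : A'.det ≠ 0 := by
    intro h; rw [h, mul_zero] at hdetA'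
    exact mul_ne_zero (pow_ne_zero 2 hTd0) hd hdetA'
  have hA'D : |A'.det| ≤ D' := by
    have h1 : |A'.det| ≤ |G.det| * |A'.det| :=
      le_mul_of_one_le_left (abs_nonneg _) (Int.one_le_abs hG)
    rw [← abs_mul, ← hdetA', abs_mul, abs_pow] at h1
    refine h1.trans ?_
    simp only [D']
    push_cast
    gcongr
  obtain ⟨U, U', hUU', hUS⟩ := hS ⟨m, hm⟩ A' hA's hA'0 hA'D
  obtain ⟨c, hc⟩ : G.det ∣ (B.factorial : ℤ) := by
    rw [← Int.natAbs_dvd]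
    apply Int.natCast_dvd_natCast.mpr
    apply Nat.dvd_factorial (Int.natAbs_pos.mpr hG)
    have : (G.det.natAbs : ℤ) ≤ B := by rw [Int.natCast_natAbs]; exact hNB
    exact_mod_cast this
  let Q1 : Matrix (Fin k ⊕ Fin m) (Fin n) ℤ := Matrix.fromRows Q.toRows₁ (U' * Q.toRows₂)
  have hTQ1 : Matrix.fromCols V (W * U) * Q1 = G.det • 1 := by
    rw [← hQ]
    conv_rhs => rw [← Matrix.fromRows_toRows Q]
    simp only [Q1]
    rw [Matrix.fromCols_mul_fromRows, Matrix.fromCols_mul_fromRows, Matrix.mul_assoc W,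
      ← Matrix.mul_assoc U, hUU', Matrix.one_mul]
  apply hS' A ((Matrix.fromCols V (W * U)).submatrix id e) (c • Q1.submatrix e id)
  · rw [Matrix.mul_smul, hsub2, hTQ1, smul_smul, hc, mul_comm]
  · rw [hsub, hblk]
    simp only [F, Set.mem_iUnion]
    exact ⟨⟨m, hm⟩, ⟨k, by omega⟩, e, (G, Uᵀ * A' * U), ⟨hGC, hUS⟩, rfl⟩

theorem formR_eq_dot (L : EvenLattice) (R : Type*) [CommRing R] (x y : Fin L.n → R) :
    formR L R x y = x ⬝ᵥ (L.B.map (Int.cast : ℤ → R) *ᵥ y) := by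
  simp only [formR, dotProduct, Matrix.mulVec, Matrix.map_apply, Finset.mul_sum]
  refine Finset.sum_congr rfl fun i _ => Finset.sum_congr rfl fun j _ => by ring

theorem dot_ext {R : Type*} [CommRing R] {n : ℕ} (A B : Matrix (Fin n) (Fin n) R)
    (h : ∀ x y, x ⬝ᵥ (A *ᵥ y) = x ⬝ᵥ (B *ᵥ y)) : A = B := by
  classical
  ext i j
  simpa using h (Pi.single i 1) (Pi.single j 1)

theorem dot_conj {R : Type*} [CommRing R] {n : ℕ} (A U : Matrix (Fin n) (Fin n) R) (x y : Fin n → R) :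
    x ⬝ᵥ ((Uᵀ * A * U) *ᵥ y) = (U *ᵥ x) ⬝ᵥ (A *ᵥ (U *ᵥ y)) := by
  rw [← Matrix.mulVec_mulVec, ← Matrix.mulVec_mulVec, Matrix.dotProduct_mulVec, Matrix.vecMul_transpose]

theorem genus_rank {L M : EvenLattice} (h : SameGenus L M) : M.n = L.n := by
  obtain ⟨e, -⟩ := h.2
  have := e.finrank_eq
  simpa using this.symm

theorem genus_det {L M : EvenLattice} (h : SameGenus L M) : M.B.det ∣ L.B.det := by
  classical
  have hr := genus_rank h
  have key : ∀ (p : ℕ) [Fact p.Prime], (M.B.det : ℤ_[p]) ∣ (L.B.det : ℤ_[p]) := by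
    intro p hp
    obtain ⟨e, he⟩ := h.1 p
    obtain ⟨n, B, h1, h2, h3⟩ := L
    obtain ⟨n', B', h1', h2', h3'⟩ := M
    simp only at hr e he ⊢
    subst hr
    simp only [formR_eq_dot] at he
    let E : Matrix (Fin n') (Fin n') ℤ_[p] := LinearMap.toMatrix' e.toLinearMap
    have hE : ∀ x, E *ᵥ x = e x := fun x => by
      simp only [E]; rw [LinearMap.toMatrix'_mulVec]; rfl
    have hc : Eᵀ * B'.map (Int.cast : ℤ → ℤ_[p]) * E = B.map (Int.cast : ℤ → ℤ_[p]) := by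
      apply dot_ext
      intro x y
      rw [dot_conj, hE, hE]; exact he x y
    have hd := congrArg Matrix.det hc
    rw [Matrix.det_mul, Matrix.det_mul] at hd
    have i1 : (B.map (Int.cast : ℤ → ℤ_[p])).det = (B.det : ℤ_[p]) := (Int.cast_det B).symm
    have i2 : (B'.map (Int.cast : ℤ → ℤ_[p])).det = (B'.det : ℤ_[p]) := (Int.cast_det B').symm
    rw [i1, i2] at hd
    exact ⟨Eᵀ.det * E.det, by rw [← hd]; ring⟩
  rw [← Int.natAbs_dvd_natAbs, Nat.dvd_iff_prime_pow_dvd_dvd]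
  intro p k hp hk
  have : Fact p.Prime := ⟨hp⟩
  have h1 : ((p : ℤ) ^ k) ∣ M.B.det := by
    rw [← Int.natCast_dvd] at hk; exact_mod_cast hk
  have h2 : (p : ℤ_[p]) ^ k ∣ (L.B.det : ℤ_[p]) :=
    ((PadicInt.pow_p_dvd_int_iff k _).mpr h1).trans (key p)
  have h3 := (PadicInt.pow_p_dvd_int_iff k _).mp h2
  rw [← Int.natCast_dvd]; exact_mod_cast h3

/-- `M` has rank `n` and Gram matrix in the class of `s`. -/
def InClass {n : ℕ} (s : Matrix (Fin n) (Fin n) ℤ) (M : EvenLattice) : Prop :=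
  ∃ e : (Fin n → ℤ) ≃ₗ[ℤ] (Fin M.n → ℤ), ∀ x y, formR M ℤ (e x) (e y) = x ⬝ᵥ (s *ᵥ y)

/-- **Finiteness of the class number.** There are only finitely many isometry classes of
even lattices in the genus of `L`: there is a finite list of even lattices such that every
even lattice in the same genus as `L` is isometric (over `ℤ`) to one of them. -/
theorem class_number_finite (L : EvenLattice) :
    ∃ (k : ℕ) (reps : Fin k → EvenLattice),
      ∀ M : EvenLattice, SameGenus L M → ∃ i, IsometricOver ℤ M (reps i) := by
  classical
  obtain ⟨S, hSf, hS⟩ := finite_classes L.n L.B.det.natAbs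
  have := hSf.to_subtype
  obtain ⟨k, ⟨f⟩⟩ := Finite.exists_equiv_fin S
  let rep : Matrix (Fin L.n) (Fin L.n) ℤ → EvenLattice := fun s =>
    if h : ∃ M, InClass s M then h.choose else L
  refine ⟨k, fun i => rep (f.symm i), ?_⟩
  intro M hM
  have hcl : ∃ s ∈ S, InClass s M := by
    have hr := genus_rank hM
    have hdv := genus_det hM
    have hle : |M.B.det| ≤ L.B.det.natAbs := by
      rw [Int.natCast_natAbs]
      exact Int.le_of_dvd (abs_pos.mpr L.nondeg) ((abs_dvd_abs _ _).mpr hdv)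
    clear hM hdv
    obtain ⟨n', B', h1', h2', h3'⟩ := M
    simp only at hr hle
    subst hr
    obtain ⟨U, U', hU, hUS⟩ := hS B' h1' h3' hle
    refine ⟨_, hUS, Matrix.toLin'OfInv (mul_eq_one_comm.mp hU) hU, ?_⟩
    intro x y
    rw [formR_eq_dot, dot_conj]
    rfl
  obtain ⟨s, hsS, hsM⟩ := hcl
  refine ⟨f ⟨s, hsS⟩, ?_⟩
  have hex : ∃ M, InClass s M := ⟨M, hsM⟩
  have hrep : rep (f.symm (f ⟨s, hsS⟩)) = hex.choose := by
    simp only [Equiv.symm_apply_apply, rep]; rw [dif_pos hex]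
  show IsometricOver ℤ M (rep (f.symm (f ⟨s, hsS⟩)))
  rw [hrep]
  obtain ⟨e1, he1⟩ := hsM
  obtain ⟨e2, he2⟩ := hex.choose_spec
  refine ⟨e1.symm.trans e2, fun x y => ?_⟩
  rw [LinearEquiv.trans_apply, LinearEquiv.trans_apply, he2, ← he1]
  simp
end

section
/- Let L and M be even unimodular lattices (i.e., L = L* and M = M*) with equal signatures (r, s), where min(r, s) ≥ 1. Then L and M are isometric. -/
open scoped BigOperators

namespace IEU
open Module

theorem orth_bound {K V : Type*} [Field K] [AddCommGroup V] [Module K V] [FiniteDimensional K V]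
    (B : LinearMap.BilinForm K V) (symm : ∀ x y, B x y = B y x)
    (nd : ∀ x, (∀ y, B x y = 0) → x = 0) (N R : Submodule K V)
    (h : ∀ n ∈ N, ∀ r ∈ R, B n r = 0) : finrank K N + finrank K R ≤ finrank K V := by
  have hB : B.Nondegenerate := by
    refine ⟨fun x hx => nd x hx, fun x hx => nd x fun y => by rw [symm]; exact hx y⟩
  have h1 := LinearMap.BilinForm.finrank_orthogonal hB N
  have h2 : R ≤ B.orthogonal N := fun r hr => by
    rw [LinearMap.BilinForm.mem_orthogonal_iff]; exact fun n hn => h n hn r hr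
  have h3 := Submodule.finrank_mono h2
  have h4 := Submodule.finrank_le N
  omega

structure Sp : Type 1 where
  V : Type
  [ag : AddCommGroup V]
  [md : Module ℚ V]
  [fd : FiniteDimensional ℚ V]
  B : LinearMap.BilinForm ℚ V
  symm : ∀ x y, B x y = B y x
  nd : ∀ x, (∀ y, B x y = 0) → x = 0

attribute [instance] Sp.ag Sp.md Sp.fd

def Sp.rel (S T : Sp) : Prop :=
  ∃ I : Submodule ℚ (S.V × T.V), (∀ u ∈ I, ∀ v ∈ I, S.B u.1 v.1 = T.B u.2 v.2) ∧
    finrank ℚ S.V + finrank ℚ T.V ≤ 2 * finrank ℚ I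

theorem Sp.rel_of_map {S T : Sp} {X : Type} [AddCommGroup X] [Module ℚ X] [FiniteDimensional ℚ X]
    (f : X →ₗ[ℚ] S.V × T.V) (hf : Function.Injective f)
    (h : ∀ u v, S.B (f u).1 (f v).1 = T.B (f u).2 (f v).2)
    (hd : finrank ℚ S.V + finrank ℚ T.V ≤ 2 * finrank ℚ X) : S.rel T := by
  refine ⟨LinearMap.range f, ?_, ?_⟩
  · rintro _ ⟨u, rfl⟩ _ ⟨v, rfl⟩; exact h u v
  · rw [LinearMap.finrank_range_of_inj hf]; exact hd

theorem Sp.rel_of_iso {S T : Sp} (e : S.V ≃ₗ[ℚ] T.V) (h : ∀ u v, T.B (e u) (e v) = S.B u v) :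
    S.rel T := by
  refine Sp.rel_of_map (LinearMap.prod LinearMap.id e.toLinearMap) ?_ ?_ ?_
  · intro a b hab
    simpa using congrArg Prod.fst hab
  · intro u v; simp [h]
  · rw [e.finrank_eq]; omega

theorem Sp.rel_symm {S T : Sp} (h : S.rel T) : T.rel S := by
  obtain ⟨I, hI, hd⟩ := h
  refine Sp.rel_of_map ((LinearEquiv.prodComm ℚ S.V T.V).toLinearMap ∘ₗ I.subtype) ?_ ?_ ?_
  · exact (LinearEquiv.prodComm ℚ S.V T.V).injective.comp I.injective_subtype
  · rintro ⟨u, hu⟩ ⟨v, hv⟩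
    simpa using (hI u hu v hv).symm
  · omega

theorem Sp.rel_trans {S T U : Sp} (h : S.rel T) (h' : T.rel U) : S.rel U := by
  obtain ⟨I, hI, hd⟩ := h
  obtain ⟨J, hJ, hd'⟩ := h'
  let pI : I →ₗ[ℚ] T.V := LinearMap.snd ℚ S.V T.V ∘ₗ I.subtype
  let pJ : J →ₗ[ℚ] T.V := LinearMap.fst ℚ T.V U.V ∘ₗ J.subtype
  let δ : (I × J) →ₗ[ℚ] T.V := pI ∘ₗ LinearMap.fst ℚ I J - pJ ∘ₗ LinearMap.snd ℚ I J
  let κ : LinearMap.ker δ →ₗ[ℚ] S.V × U.V :=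
    (LinearMap.prodMap (LinearMap.fst ℚ S.V T.V ∘ₗ I.subtype) (LinearMap.snd ℚ T.V U.V ∘ₗ J.subtype))
      ∘ₗ (LinearMap.ker δ).subtype
  have hF : ∀ z : LinearMap.ker δ, (z.1.1.1).2 = (z.1.2.1).1 := by
    intro z
    have := z.2
    have h2 : (z.1.1.1).2 - (z.1.2.1).1 = 0 := this
    exact sub_eq_zero.1 h2
  have hκ1 : ∀ z : LinearMap.ker δ, (κ z).1 = (z.1.1.1).1 := fun z => rfl
  have hκ2 : ∀ z : LinearMap.ker δ, (κ z).2 = (z.1.2.1).2 := fun z => rfl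
  refine ⟨LinearMap.range κ, ?_, ?_⟩
  · rintro _ ⟨u, rfl⟩ _ ⟨v, rfl⟩
    rw [hκ1, hκ1, hκ2, hκ2, hI _ u.1.1.2 _ v.1.1.2, hF, hF, hJ _ u.1.2.2 _ v.1.2.2]
  · have h1 := LinearMap.finrank_range_add_finrank_ker (K := ℚ) (V := LinearMap.ker δ) (V₂ := S.V × U.V) κ
    have h2 := LinearMap.finrank_range_add_finrank_ker δ
    -- the kernel embeds in the orthogonal of the range of δ
    let ν : LinearMap.ker κ →ₗ[ℚ] T.V :=
      pI ∘ₗ LinearMap.fst ℚ I J ∘ₗ (LinearMap.ker δ).subtype ∘ₗ (LinearMap.ker κ).subtype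
    have hν : Function.Injective ν := by
      rintro ⟨z, hz⟩ ⟨y, hy⟩ h0
      have h0' : (z.1.1.1).2 = (y.1.1.1).2 := h0
      have hz' : κ z = 0 := hz
      have hy' : κ y = 0 := hy
      have hz1 : (z.1.1.1).1 = (y.1.1.1).1 := by rw [← hκ1, ← hκ1, hz', hy']
      have hz2 : (z.1.2.1).2 = (y.1.2.1).2 := by rw [← hκ2, ← hκ2, hz', hy']
      have h0'' : (z.1.2.1).1 = (y.1.2.1).1 := by rw [← hF, ← hF, h0']
      apply Subtype.ext
      apply Subtype.ext
      apply Prod.ext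
      · exact Subtype.ext (Prod.ext hz1 h0')
      · exact Subtype.ext (Prod.ext h0'' hz2)
    have h3 := orth_bound T.B T.symm T.nd (LinearMap.range ν) (LinearMap.range δ) (by
      rintro _ ⟨⟨z, hz⟩, rfl⟩ _ ⟨⟨a, b⟩, rfl⟩
      have hz' : κ z = 0 := hz
      have hz1 : (z.1.1.1).1 = 0 := by rw [← hκ1, hz']; rfl
      have hz2 : (z.1.2.1).2 = 0 := by rw [← hκ2, hz']; rfl
      have e1 : ν ⟨z, hz⟩ = (z.1.1.1).2 := rfl
      have e2 : δ (a, b) = a.1.2 - b.1.1 := rfl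
      rw [e1, e2, map_sub, ← hI _ z.1.1.2 _ a.2, hF, hJ _ z.1.2.2 _ b.2, hz1, hz2]
      simp)
    rw [LinearMap.finrank_range_of_inj hν] at h3
    rw [Module.finrank_prod] at h2
    omega

theorem Sp.rel_refl (S : Sp) : S.rel S := Sp.rel_of_iso (LinearEquiv.refl ℚ _) (fun _ _ => rfl)

instance Sp.setoid : Setoid Sp := ⟨Sp.rel, Sp.rel_refl, Sp.rel_symm, Sp.rel_trans⟩

def prodForm {V W : Type*} [AddCommGroup V] [Module ℚ V] [AddCommGroup W] [Module ℚ W]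
    (B : LinearMap.BilinForm ℚ V) (C : LinearMap.BilinForm ℚ W) : LinearMap.BilinForm ℚ (V × W) :=
  B.compl₁₂ (LinearMap.fst ℚ V W) (LinearMap.fst ℚ V W) +
  C.compl₁₂ (LinearMap.snd ℚ V W) (LinearMap.snd ℚ V W)

theorem prodForm_apply {V W : Type*} [AddCommGroup V] [Module ℚ V] [AddCommGroup W] [Module ℚ W]
    (B : LinearMap.BilinForm ℚ V) (C : LinearMap.BilinForm ℚ W) (x y : V × W) :
    prodForm B C x y = B x.1 y.1 + C x.2 y.2 := rfl

def Sp.add (S T : Sp) : Sp where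
  V := S.V × T.V
  B := prodForm S.B T.B
  symm x y := by simp [prodForm_apply, S.symm x.1, T.symm x.2]
  nd x h := by
    apply Prod.ext
    · exact S.nd _ fun y => by simpa [prodForm_apply] using h (y, 0)
    · exact T.nd _ fun y => by simpa [prodForm_apply] using h (0, y)

theorem Sp.add_B (S T : Sp) (x y : (S.add T).V) : (S.add T).B x y = S.B x.1 y.1 + T.B x.2 y.2 := rfl

def Sp.neg (S : Sp) : Sp where
  V := S.V
  B := -S.B
  symm x y := by simp [S.symm x]
  nd x h := S.nd x fun y => by simpa using h y

theorem Sp.neg_B (S : Sp) (x y : (S.neg).V) : (S.neg).B x y = -(show ℚ from S.B x y) := rfl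

def Sp.zero : Sp where
  V := PUnit
  B := 0
  symm _ _ := rfl
  nd _ _ := rfl

def W : Type 1 := Quotient Sp.setoid

theorem Sp.add_congr {S S' T T' : Sp} (h : S.rel S') (h' : T.rel T') : (S.add T).rel (S'.add T') := by
  obtain ⟨I, hI, hd⟩ := h
  obtain ⟨J, hJ, hd'⟩ := h'
  refine Sp.rel_of_map (S := S.add T) (T := S'.add T')
    ((LinearEquiv.prodProdProdComm ℚ S.V S'.V T.V T'.V).toLinearMap ∘ₗ
    (LinearMap.prodMap I.subtype J.subtype)) ?_ ?_ ?_
  · refine (LinearEquiv.prodProdProdComm ℚ S.V S'.V T.V T'.V).injective.comp ?_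
    intro a b hab
    have h1 := congrArg Prod.fst hab
    have h2 := congrArg Prod.snd hab
    exact Prod.ext (Subtype.ext h1) (Subtype.ext h2)
  · rintro ⟨a, b⟩ ⟨c, d⟩
    show S.B a.1.1 c.1.1 + T.B b.1.1 d.1.1 = S'.B a.1.2 c.1.2 + T'.B b.1.2 d.1.2
    rw [hI _ a.2 _ c.2, hJ _ b.2 _ d.2]
  · have e1 : finrank ℚ (S.add T).V = finrank ℚ S.V + finrank ℚ T.V := Module.finrank_prod
    have e2 : finrank ℚ (S'.add T').V = finrank ℚ S'.V + finrank ℚ T'.V := Module.finrank_prod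
    rw [Module.finrank_prod]
    omega

theorem Sp.neg_congr {S T : Sp} (h : S.rel T) : (S.neg).rel (T.neg) := by
  obtain ⟨I, hI, hd⟩ := h
  exact ⟨I, fun u hu v hv => congrArg Neg.neg (hI u hu v hv), hd⟩

instance : Add W := ⟨Quotient.map₂ Sp.add fun _ _ h _ _ h' => Sp.add_congr h h'⟩
instance : Neg W := ⟨Quotient.map Sp.neg fun _ _ h => Sp.neg_congr h⟩
instance : Zero W := ⟨Quotient.mk _ Sp.zero⟩

def Sp.cl (S : Sp) : W := Quotient.mk _ S

theorem Sp.cl_add (S T : Sp) : (S.add T).cl = S.cl + T.cl := rfl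
theorem Sp.cl_neg (S : Sp) : (S.neg).cl = - S.cl := rfl
theorem Sp.cl_eq {S T : Sp} : S.cl = T.cl ↔ S.rel T := Quotient.eq
theorem Sp.cl_iso {S T : Sp} (e : S.V ≃ₗ[ℚ] T.V) (h : ∀ u v, T.B (e u) (e v) = S.B u v) :
   S.cl = T.cl := Sp.cl_eq.2 (Sp.rel_of_iso e h)

theorem Sp.cl_zero' (S : Sp) (h : finrank ℚ S.V = 0) : S.cl = 0 := by
  refine Sp.cl_eq.2 ?_
  refine ⟨⊥, ?_, ?_⟩
  · intro u hu v hv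
    rw [Submodule.mem_bot] at hu hv
    subst hu; simp
  · have : finrank ℚ Sp.zero.V = 0 := Module.finrank_zero_of_subsingleton (M := PUnit)
    omega

theorem Sp.cl_neg_add (a : Sp) : (a.neg.add a).cl = Sp.zero.cl := by
  refine (Sp.cl_eq (S := a.neg.add a) (T := Sp.zero)).2 ?_
  let f : a.V →ₗ[ℚ] (a.V × a.V) × PUnit := LinearMap.prod (LinearMap.prod LinearMap.id LinearMap.id) 0
  refine @Sp.rel_of_map (a.neg.add a) Sp.zero a.V _ _ a.fd f ?_ ?_ ?_
  · intro x y hxy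
    exact congrArg (fun z => z.1.1) hxy
  · intro u v
    show - a.B u v + a.B u v = 0
    ring
  · have e1 : finrank ℚ (a.neg.add a).V = finrank ℚ a.V + finrank ℚ a.V := Module.finrank_prod
    have : finrank ℚ Sp.zero.V = 0 := Module.finrank_zero_of_subsingleton (M := PUnit)
    omega

instance : AddCommGroup W where
  add_assoc := by
    rintro ⟨a⟩ ⟨b⟩ ⟨c⟩
    exact Sp.cl_iso (S := (a.add b).add c) (T := a.add (b.add c)) (LinearEquiv.prodAssoc ℚ a.V b.V c.V)
      (fun u v => (add_assoc (a.B u.1.1 v.1.1) (b.B u.1.2 v.1.2) (c.B u.2 v.2)).symm)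
  zero_add := by
    rintro ⟨a⟩
    refine Sp.cl_iso (S := Sp.zero.add a) (T := a)
      (LinearEquiv.uniqueProd (R := ℚ) (M := a.V) (M₂ := PUnit)) ?_
    intro u v
    show a.B u.2 v.2 = 0 + a.B u.2 v.2
    rw [zero_add]
  add_zero := by
    rintro ⟨a⟩
    refine Sp.cl_iso (S := a.add Sp.zero) (T := a)
      (LinearEquiv.prodUnique (R := ℚ) (M := a.V) (M₂ := PUnit)) ?_
    intro u v
    show a.B u.1 v.1 = a.B u.1 v.1 + 0
    rw [add_zero]
  add_comm := by
    rintro ⟨a⟩ ⟨b⟩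
    exact Sp.cl_iso (S := a.add b) (T := b.add a) (LinearEquiv.prodComm ℚ a.V b.V)
      (fun u v => add_comm (b.B u.2 v.2) (a.B u.1 v.1))
  nsmul := nsmulRec
  zsmul := zsmulRec
  neg_add_cancel := by
    rintro ⟨a⟩
    exact Sp.cl_neg_add a
end IEU

namespace IEU
open Module

def Sp.one (a : ℚ) (ha : a ≠ 0) : Sp where
  V := ℚ
  B := a • LinearMap.mul ℚ ℚ
  symm x y := by simp [mul_comm]
  nd x h := by simpa [ha] using h 1

theorem Sp.one_B (a : ℚ) (ha : a ≠ 0) (x y : ℚ) : (Sp.one a ha).B x y = a * (x * y) := rfl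

open Classical in
noncomputable def br (a : ℚ) : W := if h : a ≠ 0 then (Sp.one a h).cl else 0

theorem br_eq {a : ℚ} (h : a ≠ 0) : br a = (Sp.one a h).cl := dif_pos h

theorem br_sq {a b : ℚ} (ha : a ≠ 0) (hb : b ≠ 0) : br (a * b ^ 2) = br a := by
  rw [br_eq ha, br_eq (mul_ne_zero ha (pow_ne_zero 2 hb))]
  refine Sp.cl_iso (LinearEquiv.smulOfNeZero ℚ ℚ b hb) ?_
  intro (u : ℚ) (v : ℚ)
  show a * ((b * u) * (b * v)) = a * b ^ 2 * (u * v)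
  ring

theorem br_neg {a : ℚ} (ha : a ≠ 0) : br (-a) = - br a := by
  rw [br_eq ha, br_eq (neg_ne_zero.2 ha), ← Sp.cl_neg]
  refine Sp.cl_iso (LinearEquiv.refl ℚ ℚ) ?_
  intro (u : ℚ) (v : ℚ)
  show - (a * (u * v)) = (-a) * (u * v)
  ring

theorem br_add {a b : ℚ} (ha : a ≠ 0) (hb : b ≠ 0) (hab : a + b ≠ 0) :
    br a + br b = br (a + b) + br (a * b * (a + b)) := by
  rw [br_eq ha, br_eq hb, br_eq hab, br_eq (mul_ne_zero (mul_ne_zero ha hb) hab), ← Sp.cl_add,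
    ← Sp.cl_add]
  symm
  let f : (ℚ × ℚ) →ₗ[ℚ] (ℚ × ℚ) :=
    LinearMap.prod (LinearMap.fst ℚ ℚ ℚ + b • LinearMap.snd ℚ ℚ ℚ)
      (LinearMap.fst ℚ ℚ ℚ - a • LinearMap.snd ℚ ℚ ℚ)
  have hf : ∀ x, f x = (x.1 + b * x.2, x.1 - a * x.2) := fun x => rfl
  have hinj : Function.Injective f := by
    rintro ⟨x, y⟩ ⟨z, w⟩ h
    simp only [hf, Prod.mk.injEq] at h
    obtain ⟨h1, h2⟩ := h
    have h3 : (a + b) * (y - w) = 0 := by linear_combination h1 - h2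
    have h4 : y = w := by
      rcases mul_eq_zero.1 h3 with h | h
      · exact absurd h hab
      · linarith
    subst h4
    ext
    · simpa using h1
    · rfl
  refine Sp.cl_iso (LinearEquiv.ofInjectiveEndo f hinj) ?_
  intro (u : ℚ × ℚ) (v : ℚ × ℚ)
  show a * ((u.1 + b * u.2) * (v.1 + b * v.2)) + b * ((u.1 - a * u.2) * (v.1 - a * v.2)) =
    (a + b) * (u.1 * v.1) + (a * b * (a + b)) * (u.2 * v.2)
  ring

theorem br_rat {a : ℚ} (ha : a ≠ 0) : ∃ m : ℤ, m ≠ 0 ∧ br a = br m := by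
  refine ⟨a.num * a.den, mul_ne_zero (Rat.num_ne_zero.2 ha) (by exact_mod_cast a.den_nz), ?_⟩
  have hd : (a.den : ℚ) ≠ 0 := by exact_mod_cast a.den_nz
  rw [← br_sq ha hd]
  congr 1
  push_cast
  nth_rw 1 [← Rat.num_div_den a]
  field_simp

/-- matrix spaces -/
noncomputable def Sp.ofM {ι : Type} [Fintype ι] [DecidableEq ι] (G : Matrix ι ι ℚ) (hs : G.IsSymm)
    (hd : G.det ≠ 0) : Sp where
  V := ι → ℚ
  B := Matrix.toBilin' G
  symm x y := by
    rw [Matrix.toBilin'_apply', Matrix.toBilin'_apply', dotProduct_comm, Matrix.dotProduct_mulVec,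
      ← Matrix.mulVec_transpose, hs.eq, dotProduct_comm, dotProduct_comm]
  nd := (LinearMap.BilinForm.nondegenerate_toBilin'_iff_det_ne_zero.2 hd).1

theorem Sp.ofM_B {ι : Type} [Fintype ι] [DecidableEq ι] (G : Matrix ι ι ℚ) (hs : G.IsSymm)
    (hd : G.det ≠ 0) (x y : ι → ℚ) : (Sp.ofM G hs hd).B x y = ∑ i, ∑ j, x i * G i j * y j :=
  Matrix.toBilin'_apply _ _ _

/-- diagonal spaces -/
noncomputable def Sp.diag {n : ℕ} (a : Fin n → ℚ) (ha : ∀ i, a i ≠ 0) : Sp where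
  V := Fin n → ℚ
  B := LinearMap.mk₂ ℚ (fun x y => ∑ i, a i * (x i * y i))
    (by intro x y z; simp only [← Finset.sum_add_distrib, Pi.add_apply]; congr! 1; ring)
    (by intro x y z; simp only [smul_eq_mul, Finset.mul_sum, Pi.smul_apply]; congr! 1; ring)
    (by intro x y z; simp only [← Finset.sum_add_distrib, Pi.add_apply]; congr! 1; ring)
    (by intro x y z; simp only [smul_eq_mul, Finset.mul_sum, Pi.smul_apply]; congr! 1; ring)
  symm x y := by simp only [LinearMap.mk₂_apply, mul_comm]
  nd x h := by
    ext i
    have := h (Pi.single i 1)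
    simp only [LinearMap.mk₂_apply, Pi.single_apply] at this
    simpa [ha] using this

theorem Sp.diag_B {n : ℕ} (a : Fin n → ℚ) (ha : ∀ i, a i ≠ 0) (x y : Fin n → ℚ) :
    (Sp.diag a ha).B x y = ∑ i, a i * (x i * y i) := rfl

theorem Sp.diag_cl : ∀ {n : ℕ} (a : Fin n → ℚ) (ha : ∀ i, a i ≠ 0),
    (Sp.diag a ha).cl = ∑ i, br (a i)
  | 0, a, ha => by
    rw [Sp.cl_zero']
    · simp
    · exact Module.finrank_zero_of_subsingleton (M := Fin 0 → ℚ)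
  | n + 1, a, ha => by
    rw [Fin.sum_univ_succ, ← Sp.diag_cl (fun i => a (Fin.succ i)) (fun i => ha _), br_eq (ha 0),
      ← Sp.cl_add]
    symm
    refine Sp.cl_iso (Fin.consLinearEquiv ℚ (fun _ : Fin (n+1) => ℚ)) ?_
    intro (u : ℚ × (Fin n → ℚ)) (v : ℚ × (Fin n → ℚ))
    show ∑ i, a i * ((Fin.cons u.1 u.2 : Fin (n+1) → ℚ) i * (Fin.cons v.1 v.2 : Fin (n+1) → ℚ) i)
      = a 0 * (u.1 * v.1) + ∑ i : Fin n, a (Fin.succ i) * (u.2 i * v.2 i)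
    rw [Fin.sum_univ_succ]
    simp

theorem Sp.exists_diag (S : Sp) : ∃ (n : ℕ) (a : Fin n → ℤ), (∀ i, a i ≠ 0) ∧
    S.cl = ∑ i, br (a i) := by
  obtain ⟨v, hv⟩ := LinearMap.BilinForm.exists_orthogonal_basis (B := S.B) ⟨S.symm⟩
  have hsum : ∀ x y : S.V, S.B x y = ∑ i, S.B (v i) (v i) * (v.equivFun x i * v.equivFun y i) := by
    intro x y
    conv_lhs => rw [← v.sum_equivFun x, ← v.sum_equivFun y]
    simp only [map_sum, LinearMap.sum_apply, map_smul, LinearMap.smul_apply, smul_eq_mul]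
    refine Finset.sum_congr rfl fun i _ => ?_
    rw [Finset.sum_eq_single i]
    · ring
    · intro j _ hj
      have : S.B (v j) (v i) = 0 := hv hj
      rw [this]; ring
    · simp
  have hne : ∀ i, S.B (v i) (v i) ≠ 0 := by
    intro i hi
    refine v.ne_zero i (S.nd _ fun y => ?_)
    rw [hsum]
    refine Finset.sum_eq_zero fun j _ => ?_
    by_cases hij : j = i
    · subst hij; rw [hi]; ring
    · have : v.equivFun (v i) j = 0 := by simp [Finsupp.single_apply, Ne.symm hij]
      rw [this]; ring
  choose m hm0 hm using fun i => br_rat (hne i)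
  refine ⟨_, m, hm0, ?_⟩
  rw [← Finset.sum_congr rfl (fun i _ => hm i), ← Sp.diag_cl _ hne]
  refine Sp.cl_iso v.equivFun ?_
  intro u w
  rw [hsum u w]
  rfl

/-- integer matrix spaces -/
noncomputable def Sp.ofZ {ι : Type} [Fintype ι] [DecidableEq ι] (G : Matrix ι ι ℤ) (hs : G.IsSymm)
    (hd : G.det ≠ 0) : Sp :=
  Sp.ofM (G.map (Int.cast : ℤ → ℚ)) (by
    ext i j; simp [hs.apply i j]) (by
    have := (Int.castRingHom ℚ).map_det G
    intro h
    have h2 : (Int.castRingHom ℚ).mapMatrix G = G.map (Int.cast : ℤ → ℚ) := rfl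
    rw [h2, h] at this
    simp at this
    exact hd this)

theorem Sp.ofZ_B {ι : Type} [Fintype ι] [DecidableEq ι] (G : Matrix ι ι ℤ) (hs : G.IsSymm)
    (hd : G.det ≠ 0) (x y : ι → ℚ) :
    (Sp.ofZ G hs hd).B x y = ∑ i, ∑ j, x i * (G i j : ℚ) * y j :=
  Sp.ofM_B _ _ _ x y

theorem det_blk {R : Type*} [CommRing R] {ι : Type*} [Fintype ι] [DecidableEq ι] (G : Matrix ι ι R) (d : R) :
    (Matrix.fromBlocks G 0 0 (Matrix.of (fun _ _ : Unit => d))).det = G.det * d := by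
  rw [Matrix.det_fromBlocks_zero₁₂]
  congr 1
  rw [Matrix.det_unique]
  rfl

theorem Sp.ofZ_add {ι : Type} [Fintype ι] [DecidableEq ι] (G : Matrix ι ι ℤ) (hs : G.IsSymm)
    (hd : G.det ≠ 0) (d : ℤ) (hd0 : d ≠ 0) :
    ∃ (h1 : (Matrix.fromBlocks G 0 0 (Matrix.of (fun _ _ : Unit => d))).IsSymm)
      (h2 : (Matrix.fromBlocks G 0 0 (Matrix.of (fun _ _ : Unit => d))).det ≠ 0),
    (Sp.ofZ _ h1 h2).cl = (Sp.ofZ G hs hd).cl + br d := by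
  refine ⟨Matrix.IsSymm.fromBlocks hs (by simp) (by ext; rfl), by
    rw [det_blk]; exact mul_ne_zero hd hd0, ?_⟩
  have hd0' : (d : ℚ) ≠ 0 := by exact_mod_cast hd0
  rw [br_eq hd0', ← Sp.cl_add]
  let e : (ι ⊕ Unit → ℚ) ≃ₗ[ℚ] (ι → ℚ) × ℚ :=
    (LinearEquiv.sumArrowLequivProdArrow ι Unit ℚ ℚ).trans
      (LinearEquiv.prodCongr (LinearEquiv.refl ℚ _) (LinearEquiv.funUnique Unit ℚ ℚ))
  refine Sp.cl_iso e ?_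
  intro (u : ι ⊕ Unit → ℚ) (v : ι ⊕ Unit → ℚ)
  rw [Sp.ofZ_B]
  show (Sp.ofZ G hs hd).B (fun i => u (Sum.inl i)) (fun i => v (Sum.inl i)) +
    (d : ℚ) * (u (Sum.inr ()) * v (Sum.inr ())) = _
  rw [Sp.ofZ_B]
  simp only [Fintype.sum_sum_type]
  simp [Matrix.fromBlocks]
  ring
end IEU

namespace IEU

def Smooth (k : ℕ) (d : ℤ) : Prop := d ≠ 0 ∧ ∀ q : ℕ, q.Prime → (q : ℤ) ∣ d → q < k

theorem Smooth.mul {k : ℕ} {a b : ℤ} (ha : Smooth k a) (hb : Smooth k b) : Smooth k (a * b) := by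
  refine ⟨mul_ne_zero ha.1 hb.1, fun q hq h => ?_⟩
  rcases (Nat.prime_iff_prime_int.1 hq).dvd_or_dvd h with h | h
  · exact ha.2 q hq h
  · exact hb.2 q hq h

theorem Smooth.of_lt {k : ℕ} {a : ℤ} (h0 : a ≠ 0) (h : |a| < k) : Smooth k a := by
  refine ⟨h0, fun q _ h' => ?_⟩
  have := Int.le_of_dvd (abs_pos.2 h0) ((dvd_abs _ _).2 h')
  omega

theorem Smooth.of_dvd {k : ℕ} {a b : ℤ} (h : Smooth k b) (hab : a ∣ b) : Smooth k a :=
  ⟨fun h0 => h.1 (by rw [h0] at hab; exact zero_dvd_iff.1 hab), fun q hq h' => h.2 q hq (h'.trans hab)⟩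

theorem Smooth.neg {k : ℕ} {a : ℤ} (h : Smooth k a) : Smooth k (-a) := h.of_dvd (by simp)

theorem Smooth.not_dvd {p : ℕ} (hp : p.Prime) {a : ℤ} (h : Smooth p a) : ¬ (p : ℤ) ∣ a :=
  fun h' => lt_irrefl _ (h.2 p hp h')

structure WittLike (A : Type*) [AddCommGroup A] (f : ℤ → A) : Prop where
  sq : ∀ a b : ℤ, a ≠ 0 → b ≠ 0 → f (a * b ^ 2) = f a
  neg : ∀ a : ℤ, a ≠ 0 → f (-a) = - f a
  add : ∀ a b : ℤ, a ≠ 0 → b ≠ 0 → a + b ≠ 0 → f a + f b = f (a + b) + f (a * b * (a + b))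

def Lk {A : Type*} [AddCommGroup A] (f : ℤ → A) (k : ℕ) : AddSubgroup A :=
  AddSubgroup.closure (f '' {d | Smooth k d})

section
variable {A : Type*} [AddCommGroup A] {f : ℤ → A}

theorem mem_Lk {k : ℕ} {d : ℤ} (hd : Smooth k d) : f d ∈ Lk f k :=
  AddSubgroup.subset_closure ⟨d, hd, rfl⟩

theorem Lk_two (hf : WittLike A f) {z : A} (hz : z ∈ Lk f 2) : ∃ k : ℤ, z = k • f 1 := by
  have : Lk f 2 ≤ AddSubgroup.zmultiples (f 1) := by
    rw [Lk, AddSubgroup.closure_le]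
    rintro _ ⟨d, hd, rfl⟩
    have h1 : d.natAbs = 1 := by
      by_contra h
      obtain ⟨q, hq, hqd⟩ := Nat.exists_prime_and_dvd h
      have := hd.2 q hq (Int.natCast_dvd.2 hqd)
      have := hq.two_le
      omega
    rcases Int.natAbs_eq d with h | h <;> rw [h1] at h <;> subst h
    · exact AddSubgroup.mem_zmultiples _
    · have := hf.neg 1 one_ne_zero
      simp only [Nat.cast_one]
      rw [this]
      exact neg_mem (AddSubgroup.mem_zmultiples _)
  obtain ⟨k, hk⟩ := AddSubgroup.mem_zmultiples_iff.1 (this hz)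
  exact ⟨k, hk.symm⟩

theorem Lk_notprime {k : ℕ} (hk : ¬ k.Prime) : Lk f (k + 1) ≤ Lk f k := by
  rw [Lk, AddSubgroup.closure_le]
  rintro _ ⟨d, hd, rfl⟩
  refine mem_Lk ⟨hd.1, fun q hq h => ?_⟩
  have := hd.2 q hq h
  rcases Nat.lt_succ_iff_lt_or_eq.1 this with h | h
  · exact h
  · subst h; exact absurd hq hk


/-- congruence modulo `Lk f p` in quotient -/
theorem step (hf : WittLike A f) (p : ℕ) [hp : Fact p.Prime] (c a b l : ℤ) (hc : Smooth p c) (ha : Smooth p a) (hb : Smooth p b)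
    (hl : l = 0 ∨ Smooth p l) (h : a = b + p * l) :
    (QuotientAddGroup.mk (f (p * c * a)) : A ⧸ Lk f p) = QuotientAddGroup.mk (f (p * c * b)) := by
  have hp0 : (p : ℤ) ≠ 0 := by exact_mod_cast hp.1.ne_zero
  have hp0' : p ≠ 0 := hp.1.ne_zero
  rcases hl with rfl | hl
  · simp at h; rw [h]
  · rw [QuotientAddGroup.eq]
    have h1 := hf.add (p * c * b) (p * c * (p * l)) (by simp [hp0', hc.1, hb.1])
      (by simp [hp0', hc.1, hl.1]) (by rw [← mul_add, ← h]; simp [hp0', hc.1, ha.1])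
    rw [← mul_add, ← h] at h1
    have h2 := hf.sq (c * l) p (mul_ne_zero hc.1 hl.1) hp0
    have h3 := hf.sq (b * l * a * c) (p ^ 2 * c) (by simp [hb.1, hl.1, ha.1, hc.1])
      (by simp [hp0', hc.1])
    rw [show (p : ℤ) * c * (p * l) = c * l * p ^ 2 by ring, h2,
      show (p : ℤ) * c * b * (c * l * p ^ 2) * (p * c * a) = (b * l * a * c) * (p ^ 2 * c) ^ 2 by ring,
      h3] at h1
    have h4 : -f (p * c * a) + f (p * c * b) = f (b * l * a * c) - f (c * l) := by
      rw [neg_add_eq_sub, sub_eq_sub_iff_add_eq_add, h1, add_comm]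
    rw [h4]
    exact sub_mem (mem_Lk (((hb.mul hl).mul ha).mul hc)) (mem_Lk (hc.mul hl))

def hh (f : ℤ → A) (p : ℕ) (u : ZMod p) : A ⧸ Lk f p := QuotientAddGroup.mk (f (p * (u.val : ℤ)))

theorem emod_smooth {p : ℕ} (hp : p.Prime) {u : ℤ} (hu : Smooth p u) : Smooth p (u % p) := by
  have hpp : (0 : ℤ) < p := by exact_mod_cast hp.pos
  have h1 := Int.emod_nonneg u hpp.ne'
  have h2 := Int.emod_lt_of_pos u hpp
  refine Smooth.of_lt (fun h => hu.not_dvd hp (Int.dvd_of_emod_eq_zero h)) ?_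
  rw [abs_of_nonneg h1]; exact h2

theorem base (hf : WittLike A f) (p : ℕ) [hp : Fact p.Prime] (c a b : ℤ) (hc : Smooth p c) (ha0 : a ≠ 0) (ha : |a| < p) (hb : Smooth p b)
    (hbp : |b| < p) :
    (QuotientAddGroup.mk (f (p * c * (a * b))) : A ⧸ Lk f p) =
      QuotientAddGroup.mk (f (p * c * ((a * b) % p))) := by
  have hpp : (0 : ℤ) < p := by exact_mod_cast hp.1.pos
  have has := Smooth.of_lt ha0 ha
  have hab := has.mul hb
  refine step hf p c (a * b) ((a * b) % p) (a * b / p) hc hab (emod_smooth hp.1 hab) ?_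
    (Int.emod_add_mul_ediv _ _).symm
  by_cases h0 : a * b / p = 0
  · exact Or.inl h0
  · refine Or.inr (Smooth.of_lt h0 ?_)
    have h1 := Int.emod_nonneg (a * b) hpp.ne'
    have h2 := Int.emod_lt_of_pos (a * b) hpp
    have h3 := Int.emod_add_mul_ediv (a * b) p
    have h4 : |a * b| ≤ (p - 1) * (p - 1) := by
      rw [abs_mul]
      exact mul_le_mul (by omega) (by omega) (abs_nonneg _) (by omega)
    obtain ⟨h5, h6⟩ := abs_le.1 h4
    rw [abs_lt]
    constructor
    · by_contra h
      push Not at h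
      nlinarith
    · by_contra h
      push Not at h
      nlinarith

theorem claimNat (hf : WittLike A f) (p : ℕ) [hp : Fact p.Prime] (u : ℕ) : ∀ c : ℤ, Smooth p c → Smooth p (u : ℤ) →
    (QuotientAddGroup.mk (f (p * c * u)) : A ⧸ Lk f p) =
      QuotientAddGroup.mk (f (p * c * ((u : ℤ) % p))) := by
  have hpp : (0 : ℤ) < p := by exact_mod_cast hp.1.pos
  induction u using Nat.strong_induction_on with
  | _ u ih =>
    intro c hc hu
    by_cases h1 : u = 1
    · subst h1
      rw [Nat.cast_one, Int.emod_eq_of_lt (by norm_num) (by exact_mod_cast hp.1.one_lt)]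
    · obtain ⟨q, hq, ⟨v, rfl⟩⟩ := Nat.exists_prime_and_dvd h1
      have hv0 : v ≠ 0 := by rintro rfl; exact hu.1 (by simp)
      have hqs : Smooth p (q : ℤ) := hu.of_dvd (by push_cast; exact dvd_mul_right _ _)
      have hvs : Smooth p (v : ℤ) := hu.of_dvd (by push_cast; exact dvd_mul_left _ _)
      have hlt : v < q * v := by
        have := hq.two_le
        have := Nat.pos_of_ne_zero hv0
        nlinarith
      have hi := ih v hlt (c * q) (hc.mul hqs) hvs
      have hqp : q < p := hqs.2 q hq dvd_rfl
      have h1 := Int.emod_nonneg (v : ℤ) hpp.ne'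
      have h2 := Int.emod_lt_of_pos (v : ℤ) hpp
      have hb := base hf p c q ((v : ℤ) % p) hc hqs.1 (by rw [abs_of_nonneg (by positivity)]; exact_mod_cast hqp)
        (emod_smooth hp.1 hvs) (by rw [abs_of_nonneg h1]; exact h2)
      push_cast
      rw [show (p : ℤ) * c * (q * v) = p * (c * q) * v by ring, hi,
        show (p : ℤ) * (c * q) * (v % p) = p * c * (q * (v % p)) by ring, hb]
      have e : (q : ℤ) * (v % p) % p = q * v % p := Int.ModEq.mul_left _ (Int.mod_modEq (v : ℤ) p)
      rw [e]

theorem claim (hf : WittLike A f) (p : ℕ) [hp : Fact p.Prime] (u : ℤ) (hu : Smooth p u) :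
    (QuotientAddGroup.mk (f (p * u)) : A ⧸ Lk f p) = hh f p (u : ZMod p) := by
  have hpp : (0 : ℤ) < p := by exact_mod_cast hp.1.pos
  have h1s : Smooth p 1 := Smooth.of_lt one_ne_zero (by simpa using hp.1.one_lt)
  have hval : (((u : ZMod p).val : ℕ) : ℤ) = u % p := ZMod.val_intCast u
  rw [hh, hval]
  rcases Int.natAbs_eq u with h | h
  · have := claimNat hf p u.natAbs 1 h1s (by rw [← h]; exact hu)
    rw [← h] at this
    simpa using this
  · have hs : Smooth p (u.natAbs : ℤ) := by
      have := hu.neg; rw [h] at this; simpa using this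
    have h2 := claimNat hf p u.natAbs (-1) h1s.neg hs
    have h3 := Int.emod_nonneg (u.natAbs : ℤ) hpp.ne'
    have h4 := Int.emod_lt_of_pos (u.natAbs : ℤ) hpp
    have h5 := base hf p 1 (-1) ((u.natAbs : ℤ) % p) h1s (by norm_num)
      (by simpa using hp.1.one_lt) (emod_smooth hp.1 hs) (by rw [abs_of_nonneg h3]; exact h4)
    have e1 : (p : ℤ) * (-1) * u.natAbs = p * u := by
      conv_rhs => rw [h]
      ring
    have e2 : (-1 * ((u.natAbs : ℤ) % p)) % p = u % p := by
      conv_rhs => rw [h]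
      rw [neg_one_mul]
      exact ((Int.mod_modEq (u.natAbs : ℤ) p).neg)
    rw [e1] at h2
    rw [h2, ← e2, show (p : ℤ) * -1 * (u.natAbs % p) = p * 1 * (-1 * ((u.natAbs : ℤ) % p)) by ring, h5, mul_one]

theorem val_smooth (p : ℕ) [hp : Fact p.Prime] (u : ZMod p) (hu : u ≠ 0) : Smooth p (u.val : ℤ) := by
  refine Smooth.of_lt ?_ ?_
  · exact_mod_cast (ZMod.val_ne_zero u).2 hu
  · rw [abs_of_nonneg (by positivity)]; exact_mod_cast ZMod.val_lt u

theorem cast_val (p : ℕ) [hp : Fact p.Prime] (u : ZMod p) : (((u.val : ℕ) : ℤ) : ZMod p) = u := by simp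

theorem hh_sq (hf : WittLike A f) (p : ℕ) [hp : Fact p.Prime] (u v : ZMod p) (hu : u ≠ 0) (hv : v ≠ 0) : hh f p (u * v ^ 2) = hh f p u := by
  have hp0 : (p : ℤ) ≠ 0 := by exact_mod_cast hp.1.ne_zero
  have h1 := val_smooth p u hu
  have h2 := val_smooth p v hv
  have h3 := claim hf p _ (h1.mul (h2.mul h2))
  symm
  rw [hh, ← hf.sq (p * u.val) v.val (mul_ne_zero hp0 h1.1) h2.1,
    show (p : ℤ) * u.val * (v.val : ℤ) ^ 2 = p * (u.val * (v.val * v.val)) by ring, h3]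
  congr 1
  push_cast [cast_val]
  simp [sq]

theorem hh_neg (hf : WittLike A f) (p : ℕ) [hp : Fact p.Prime] (u : ZMod p) (hu : u ≠ 0) : hh f p (-u) = - hh f p u := by
  have hp0 : (p : ℤ) ≠ 0 := by exact_mod_cast hp.1.ne_zero
  have h1 := val_smooth p u hu
  have h3 := claim hf p _ h1.neg
  rw [mul_neg, hf.neg _ (mul_ne_zero hp0 h1.1)] at h3
  rw [hh, hh] at *
  simp only [Int.cast_neg, cast_val] at h3
  rw [← h3]; rfl

theorem hh_add (hf : WittLike A f) (p : ℕ) [hp : Fact p.Prime] (u v : ZMod p) (hu : u ≠ 0) (hv : v ≠ 0) (huv : u + v ≠ 0) :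
    hh f p u + hh f p v = hh f p (u + v) + hh f p (u * v * (u + v)) := by
  have hp0 : (p : ℤ) ≠ 0 := by exact_mod_cast hp.1.ne_zero
  have h1 := val_smooth p u hu
  have hv' : -v ≠ 0 := neg_ne_zero.2 hv
  have h2 := (val_smooth p (-v) hv').neg
  set a : ℤ := (u.val : ℤ) with ha
  set b : ℤ := -((-v).val : ℤ) with hb
  have hua : (a : ZMod p) = u := cast_val p u
  have hvb : (b : ZMod p) = v := by rw [hb, Int.cast_neg, cast_val]; simp
  have hab0 : a + b ≠ 0 := by
    intro h
    apply huv
    rw [← hua, ← hvb, ← Int.cast_add, h]; simp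
  have hlt : |a + b| < p := by
    have e1 := ZMod.val_lt u
    have e2 := ZMod.val_lt (-v)
    rw [abs_lt]
    constructor <;> omega
  have h3 := Smooth.of_lt hab0 hlt
  have h4 := hf.add (p * a) (p * b) (mul_ne_zero hp0 h1.1) (mul_ne_zero hp0 h2.1)
    (by rw [← mul_add]; exact mul_ne_zero hp0 hab0)
  have h5 := hf.sq (p * (a * b * (a + b))) p (mul_ne_zero hp0 (mul_ne_zero (mul_ne_zero h1.1 h2.1) hab0)) hp0
  rw [← mul_add, show (p : ℤ) * a * (p * b) * (p * (a + b)) = p * (a * b * (a + b)) * p ^ 2 by ring, h5] at h4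
  have h6 := congrArg (QuotientAddGroup.mk (s := Lk f p)) h4
  rw [QuotientAddGroup.mk_add, QuotientAddGroup.mk_add, claim hf p _ h1, claim hf p _ h2, claim hf p _ h3,
    claim hf p _ ((h1.mul h2).mul h3)] at h6
  push_cast at h6
  rw [hua, hvb] at h6
  exact h6
end
end IEU

namespace IEU

theorem shorten {K Q : Type*} [Field K] [AddCommGroup Q] (h : K → Q)
    (hneg : ∀ u, u ≠ 0 → h (-u) = - h u)
    (hadd : ∀ u v, u ≠ 0 → v ≠ 0 → u + v ≠ 0 → h u + h v = h (u + v) + h (u * v * (u + v))) :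
    ∀ (l : List K) (s : K), s ≠ 0 → (∀ x ∈ l, x ≠ 0) → s + l.sum = 0 →
      ∃ l' : List K, (∀ x ∈ l', x ≠ 0) ∧ l'.length < l.length + 1 ∧ h s + (l.map h).sum = (l'.map h).sum
  | [], s, hs, _, h0 => by simp at h0; exact absurd h0 hs
  | a :: t, s, hs, hl, h0 => by
    have ha : a ≠ 0 := hl a (by simp)
    have ht : ∀ x ∈ t, x ≠ 0 := fun x hx => hl x (by simp [hx])
    by_cases hsa : s + a = 0
    · refine ⟨t, ht, by simp, ?_⟩
      have : s = -a := by linear_combination hsa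
      rw [this, hneg a ha]; simp
    · obtain ⟨l', h1, h2, h3⟩ := shorten h hneg hadd t (s + a) hsa ht (by
        rw [← h0, List.sum_cons]; ring)
      refine ⟨(s * a * (s + a)) :: l', ?_, ?_, ?_⟩
      · intro x hx
        rcases List.mem_cons.1 hx with rfl | hx
        · exact mul_ne_zero (mul_ne_zero hs ha) hsa
        · exact h1 x hx
      · simp; omega
      · simp only [List.map_cons, List.sum_cons]
        rw [← h3, ← add_assoc, hadd s a hs ha hsa]; abel

/-- a list with a nontrivial isotropic vector can be shortened -/
theorem shorten_iso {K Q : Type*} [Field K] [AddCommGroup Q] (h : K → Q)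
    (hsq : ∀ u v, u ≠ 0 → v ≠ 0 → h (u * v ^ 2) = h u)
    (hneg : ∀ u, u ≠ 0 → h (-u) = - h u)
    (hadd : ∀ u v, u ≠ 0 → v ≠ 0 → u + v ≠ 0 → h u + h v = h (u + v) + h (u * v * (u + v)))
    {t : ℕ} (w : Fin t → K) (hw : ∀ i, w i ≠ 0) (x : Fin t → K) (hx : x ≠ 0)
    (h0 : ∑ i, w i * x i ^ 2 = 0) :
    ∃ l' : List K, (∀ y ∈ l', y ≠ 0) ∧ l'.length < t ∧ ∑ i, h (w i) = (l'.map h).sum := by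
  classical
  obtain ⟨i0, hi0⟩ := Function.ne_iff.1 hx
  simp only [Pi.zero_apply] at hi0
  let S : Finset (Fin t) := Finset.univ.filter fun i => x i ≠ 0
  have hS0 : i0 ∈ S := by simp [S, hi0]
  let l1 : List K := ((S.erase i0).toList).map fun i => w i * x i ^ 2
  let l2 : List K := (Sᶜ.toList).map w
  have e0 : ∑ i, w i * x i ^ 2 = ∑ i ∈ S, w i * x i ^ 2 := by
    symm
    apply Finset.sum_subset (Finset.subset_univ _)
    intro i _ hi
    have : x i = 0 := by simpa [S] using hi
    simp [this]
  have hl1 : l1.sum = ∑ i ∈ S.erase i0, w i * x i ^ 2 := by simp [l1]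
  obtain ⟨l', h1, h2, h3⟩ := shorten h hneg hadd l1 (w i0 * x i0 ^ 2)
    (mul_ne_zero (hw _) (pow_ne_zero _ hi0)) (by
      intro y hy
      simp only [l1, List.mem_map, Finset.mem_toList] at hy
      obtain ⟨i, hi, rfl⟩ := hy
      have : x i ≠ 0 := by
        have := Finset.mem_of_mem_erase hi
        simpa [S] using this
      exact mul_ne_zero (hw _) (pow_ne_zero _ this)) (by
      rw [hl1, Finset.add_sum_erase S (fun i => w i * x i ^ 2) hS0, ← e0, h0])
  refine ⟨l' ++ l2, ?_, ?_, ?_⟩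
  · intro y hy
    rcases List.mem_append.1 hy with hy | hy
    · exact h1 y hy
    · simp only [l2, List.mem_map] at hy
      obtain ⟨i, _, rfl⟩ := hy
      exact hw i
  · have e1 : l1.length = S.card - 1 := by simp [l1, Finset.card_erase_of_mem hS0]
    have e2 : l2.length = t - S.card := by simp [l2, Finset.card_compl]
    have e3 : 0 < S.card := Finset.card_pos.2 ⟨_, hS0⟩
    have e4 : S.card ≤ t := by simpa using Finset.card_le_univ S
    rw [List.length_append]; omega
  · rw [List.map_append, List.sum_append, ← h3]
    have e1 : (l1.map h).sum = ∑ i ∈ S.erase i0, h (w i) := by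
      simp only [l1, List.map_map]
      rw [Finset.sum_map_toList]
      refine Finset.sum_congr rfl fun i hi => ?_
      have : x i ≠ 0 := by
        have := Finset.mem_of_mem_erase hi
        simpa [S] using this
      exact hsq _ _ (hw _) this
    have e2 : (l2.map h).sum = ∑ i ∈ Sᶜ, h (w i) := by
      simp only [l2, List.map_map]
      rw [Finset.sum_map_toList]
      rfl
    rw [e1, e2, hsq _ _ (hw _) hi0, Finset.add_sum_erase S (fun i => h (w i)) hS0,
      Finset.sum_add_sum_compl]

theorem gen_mem {A : Type*} [AddCommGroup A] {f : ℤ → A} (hf : WittLike A f) (p : ℕ)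
    [hp : Fact p.Prime] : ∀ (n : ℕ) (d : ℤ), d.natAbs ≤ n → Smooth (p + 1) d →
    ∃ l : List (ZMod p), (∀ x ∈ l, x ≠ 0) ∧
      (QuotientAddGroup.mk (f d) : A ⧸ Lk f p) = (l.map (hh f p)).sum
  | 0, d, hn, hd => absurd (Int.natAbs_eq_zero.1 (Nat.le_zero.1 hn)) hd.1
  | n + 1, d, hn, hd => by
    have hp0 : (p : ℤ) ≠ 0 := by exact_mod_cast hp.1.ne_zero
    have key : ∀ e : ℤ, e ∣ d → ¬ (p : ℤ) ∣ e → Smooth p e := by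
      intro e he hpe
      refine ⟨(hd.of_dvd he).1, fun q hq h => ?_⟩
      have := (hd.of_dvd he).2 q hq h
      rcases Nat.lt_succ_iff_lt_or_eq.1 this with h' | h'
      · exact h'
      · subst h'; exact absurd h hpe
    by_cases h1 : (p : ℤ) ∣ d
    · obtain ⟨e, he⟩ := h1
      by_cases h2 : (p : ℤ) ∣ e
      · obtain ⟨g, hg⟩ := h2
        have hg0 : g ≠ 0 := by rintro rfl; apply hd.1; rw [he, hg]; simp
        have hgs : Smooth (p + 1) g := hd.of_dvd ⟨p * p, by rw [he, hg]; ring⟩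
        have e1 : f d = f g := by
          rw [← hf.sq g p hg0 hp0]; congr 1; rw [he, hg]; ring
        rw [e1]
        refine gen_mem hf p n g ?_ hgs
        have : d.natAbs = p * (p * g.natAbs) := by rw [he, hg]; simp [Int.natAbs_mul]
        have h3 : 0 < g.natAbs := Int.natAbs_pos.2 hg0
        have h4 := hp.1.two_le
        have h5 : 2 * g.natAbs ≤ p * g.natAbs := Nat.mul_le_mul_right _ h4
        have h6 : 2 * (p * g.natAbs) ≤ p * (p * g.natAbs) := Nat.mul_le_mul_right _ h4
        omega
      · have hes := key e ⟨p, by rw [he]; ring⟩ h2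
        refine ⟨[(e : ZMod p)], ?_, ?_⟩
        · intro x hx
          rw [List.mem_singleton] at hx
          subst hx
          rwa [Ne, ZMod.intCast_zmod_eq_zero_iff_dvd]
        · rw [he, claim hf p e hes]; simp
    · refine ⟨[], by simp, ?_⟩
      simp only [List.map_nil, List.sum_nil]
      exact (QuotientAddGroup.eq_zero_iff _).2 (mem_Lk (key d dvd_rfl h1))

theorem list_mem {A : Type*} [AddCommGroup A] {f : ℤ → A} (hf : WittLike A f) (p : ℕ)
    [hp : Fact p.Prime] {z : A} (hz : z ∈ Lk f (p + 1)) :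
    ∃ l : List (ZMod p), (∀ x ∈ l, x ≠ 0) ∧
      (QuotientAddGroup.mk z : A ⧸ Lk f p) = (l.map (hh f p)).sum := by
  induction hz using AddSubgroup.closure_induction with
  | mem x hx =>
    obtain ⟨d, hd, rfl⟩ := hx
    exact gen_mem hf p _ d le_rfl hd
  | zero => exact ⟨[], by simp, by simp⟩
  | add x y _ _ hx hy =>
    obtain ⟨l, h1, h2⟩ := hx
    obtain ⟨m, h3, h4⟩ := hy
    refine ⟨l ++ m, ?_, ?_⟩
    · intro x hx
      rcases List.mem_append.1 hx with h | h
      · exact h1 x h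
      · exact h3 x h
    · rw [QuotientAddGroup.mk_add, h2, h4]; simp
  | neg x _ hx =>
    obtain ⟨l, h1, h2⟩ := hx
    refine ⟨l.map Neg.neg, ?_, ?_⟩
    · intro x hx
      obtain ⟨y, hy, rfl⟩ := List.mem_map.1 hx
      exact neg_ne_zero.2 (h1 y hy)
    · rw [QuotientAddGroup.mk_neg, h2]
      clear h2
      induction l with
      | nil => simp
      | cons a t ih =>
        simp only [List.map_cons, List.sum_cons, neg_add]
        rw [ih (fun x hx => h1 x (by simp [hx])), hh_neg hf p a (h1 a (by simp))]

theorem residue_form {A : Type*} [AddCommGroup A] {f : ℤ → A} (hf : WittLike A f) (p : ℕ)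
    [hp : Fact p.Prime] {z : A} (hz : z ∈ Lk f (p + 1)) :
    ∃ (t : ℕ) (w : Fin t → ZMod p), (∀ i, w i ≠ 0) ∧
      (∀ x : Fin t → ZMod p, ∑ i, w i * x i ^ 2 = 0 → x = 0) ∧
      z - ∑ i, f (p * ((w i).val : ℤ)) ∈ Lk f p := by
  classical
  let P : ℕ → Prop := fun n => ∃ l : List (ZMod p), l.length = n ∧ (∀ x ∈ l, x ≠ 0) ∧
      (QuotientAddGroup.mk z : A ⧸ Lk f p) = (l.map (hh f p)).sum
  have hP : ∃ n, P n := by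
    obtain ⟨l, h1, h2⟩ := list_mem hf p hz
    exact ⟨_, l, rfl, h1, h2⟩
  obtain ⟨l, hl, h1, h2⟩ := Nat.find_spec hP
  have hsum : ∑ i : Fin l.length, hh f p (l.get i) = (l.map (hh f p)).sum := by
    rw [← List.sum_ofFn]
    congr 1
    exact (List.ofFn_comp' l.get (hh f p)).trans (by simp)
  refine ⟨l.length, l.get, fun i => h1 _ (l.get_mem i), ?_, ?_⟩
  · intro x hx
    by_contra hx0
    obtain ⟨l', h3, h4, h5⟩ := shorten_iso (hh f p) (hh_sq hf p) (hh_neg hf p) (hh_add hf p) l.get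
      (fun i => h1 _ (l.get_mem i)) x hx0 hx
    refine Nat.find_min hP (m := l'.length) (by omega) ⟨l', rfl, h3, ?_⟩
    rw [h2, ← hsum, h5]
  · rw [← QuotientAddGroup.eq_zero_iff, QuotientAddGroup.mk_sub, h2, ← hsum, sub_eq_zero]
    have : (QuotientAddGroup.mk (∑ i, f (p * ((l.get i).val : ℤ))) : A ⧸ Lk f p) =
      QuotientAddGroup.mk' (Lk f p) (∑ i, f (p * ((l.get i).val : ℤ))) := rfl
    rw [this, map_sum]
    rfl

end IEU

namespace IEU
open Module

theorem clr {ι : Type*} [Finite ι] (u : ι → ℚ) : ∃ N : ℤ, N ≠ 0 ∧ ∃ x : ι → ℤ, ∀ i, (x i : ℚ) = N * u i := by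
  obtain ⟨b, hb⟩ := IsLocalization.exist_integer_multiples_of_finite (nonZeroDivisors ℤ) u
  choose x hx using hb
  refine ⟨b, nonZeroDivisors.coe_ne_zero b, x, fun i => ?_⟩
  have := hx i
  simpa using this

def cst (ι κ : Type*) : ((ι → ℤ) × (κ → ℤ)) →ₗ[ℤ] ((ι → ℚ) × (κ → ℚ)) where
  toFun x := (fun i => (x.1 i : ℚ), fun i => (x.2 i : ℚ))
  map_add' x y := by ext <;> simp
  map_smul' x y := by ext <;> simp

def redp (p : ℕ) (ι κ : Type*) : ((ι → ℤ) × (κ → ℤ)) →+ ((ι → ZMod p) × (κ → ZMod p)) where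
  toFun x := (fun i => (x.1 i : ZMod p), fun i => (x.2 i : ZMod p))
  map_add' x y := by ext <;> simp
  map_zero' := by ext <;> simp

theorem redp_smul (p : ℕ) (ι κ : Type*) (n : ℤ) (x : (ι → ℤ) × (κ → ℤ)) :
    redp p ι κ (n • x) = (n : ZMod p) • redp p ι κ x := by
  ext <;> simp [redp]

theorem residue_zero (p : ℕ) [hp : Fact p.Prime] {ι : Type} [Fintype ι] [DecidableEq ι]
    (G : Matrix ι ι ℤ) (hs : G.IsSymm) (hd : (G.map (Int.cast : ℤ → ZMod p)).det ≠ 0)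
    (t : ℕ) (w : Fin t → ZMod p) (hw : ∀ x : Fin t → ZMod p, ∑ i, w i * x i ^ 2 = 0 → x = 0)
    (I : Submodule ℚ ((ι → ℚ) × (Fin t → ℚ)))
    (hI : ∀ u ∈ I, ∀ v ∈ I, ∑ i, ∑ j, u.1 i * (G i j : ℚ) * v.1 j =
      ∑ i, ((p * ((w i).val : ℤ) : ℤ) : ℚ) * (u.2 i * v.2 i))
    (hdim : Fintype.card ι + t ≤ 2 * finrank ℚ I) : t = 0 := by
  have hp0 : (p : ℤ) ≠ 0 := by exact_mod_cast hp.1.ne_zero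
  let J : Submodule ℤ ((ι → ℤ) × (Fin t → ℤ)) := (I.restrictScalars ℤ).comap (cst ι (Fin t))
  have hJ : ∀ x, x ∈ J ↔ cst ι (Fin t) x ∈ I := fun x => Iff.rfl
  let b := Module.Free.chooseBasis ℤ J
  let κ := Module.Free.ChooseBasisIndex ℤ J
  have c1 : finrank ℚ I ≤ Fintype.card κ := by
    have h1 : I ≤ Submodule.span ℚ (Set.range fun k : κ => cst ι (Fin t) (b k)) := by
      intro u hu
      obtain ⟨N, hN, x, hx⟩ := clr (Sum.elim u.1 u.2)
      let y : (ι → ℤ) × (Fin t → ℤ) := (fun i => x (Sum.inl i), fun i => x (Sum.inr i))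
      have hy : cst ι (Fin t) y = (N : ℚ) • u := by
        ext i
        · simpa [cst, y] using hx (Sum.inl i)
        · simpa [cst, y] using hx (Sum.inr i)
      have hyJ : y ∈ J := by rw [hJ, hy]; exact I.smul_mem _ hu
      have h2 := congrArg (fun z : J => cst ι (Fin t) z.1) (b.sum_repr ⟨y, hyJ⟩)
      simp only [Submodule.coe_sum, map_sum, Submodule.coe_smul, map_smul] at h2
      have hN' : (N : ℚ) ≠ 0 := by exact_mod_cast hN
      have h3 : u = (N : ℚ)⁻¹ • cst ι (Fin t) y := by rw [hy, smul_smul, inv_mul_cancel₀ hN', one_smul]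
      rw [h3, ← h2]
      refine Submodule.smul_mem _ _ (Submodule.sum_mem _ fun k _ => ?_)
      rw [← Int.cast_smul_eq_zsmul ℚ]
      exact Submodule.smul_mem _ _ (Submodule.subset_span ⟨k, rfl⟩)
    exact (Submodule.finrank_mono h1).trans (finrank_range_le_card _)
  let Φ : (κ → ZMod p) →ₗ[ZMod p] ((ι → ZMod p) × (Fin t → ZMod p)) :=
    Fintype.linearCombination (ZMod p) (fun k => redp p ι (Fin t) (b k))
  let lft : (κ → ZMod p) → J := fun c => ∑ k, ((c k).val : ℤ) • b k
  have hlft : ∀ c, redp p ι (Fin t) (lft c).1 = Φ c := by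
    intro c
    simp only [lft, Submodule.coe_sum, map_sum, Submodule.coe_smul, redp_smul, Φ,
      Fintype.linearCombination_apply]
    simp
  have hinj : ∀ c, Φ c = 0 → c = 0 := by
    intro c hc
    rw [← hlft] at hc
    have h1 : ∀ i, (p : ℤ) ∣ (lft c).1.1 i := fun i => by
      rw [← ZMod.intCast_zmod_eq_zero_iff_dvd]
      exact congrFun (congrArg Prod.fst hc) i
    have h2 : ∀ i, (p : ℤ) ∣ (lft c).1.2 i := fun i => by
      rw [← ZMod.intCast_zmod_eq_zero_iff_dvd]
      exact congrFun (congrArg Prod.snd hc) i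
    choose y1 hy1 using h1
    choose y2 hy2 using h2
    have hy : (lft c).1 = (p : ℤ) • ((y1, y2) : (ι → ℤ) × (Fin t → ℤ)) := by
      ext i
      · simpa using hy1 i
      · simpa using hy2 i
    have hyJ : ((y1, y2) : (ι → ℤ) × (Fin t → ℤ)) ∈ J := by
      have h3 := (lft c).2
      rw [hJ, hy, map_smul, ← Int.cast_smul_eq_zsmul ℚ] at h3
      rw [hJ]
      exact (Submodule.smul_mem_iff _ (by exact_mod_cast hp0)).1 h3
    have h4 : lft c = (p : ℤ) • (⟨_, hyJ⟩ : J) := Subtype.ext hy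
    funext k
    have h5 := congrArg (fun z => b.repr z k) h4
    simp only [lft, map_sum, map_smul, Finsupp.coe_finsetSum, Finset.sum_apply,
      Finsupp.smul_apply, Basis.repr_self, smul_eq_mul, Finsupp.single_apply] at h5
    have h6 := congrArg (Int.cast : ℤ → ZMod p) h5
    simpa using h6
  have hint : ∀ x ∈ J, ∀ y ∈ J, ∑ i, ∑ j, x.1 i * G i j * y.1 j =
      ∑ i, (p * ((w i).val : ℤ)) * (x.2 i * y.2 i) := by
    intro x hx y hy
    have := hI _ hx _ hy
    simp only [cst, LinearMap.coe_mk, AddHom.coe_mk] at this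
    exact_mod_cast this
  let π : (κ → ZMod p) →ₗ[ZMod p] (ι → ZMod p) := LinearMap.fst _ _ _ ∘ₗ Φ
  have hπ : ∀ c i, π c i = ((lft c).1.1 i : ZMod p) := by
    intro c i
    show (Φ c).1 i = _
    rw [← hlft]; rfl
  have hS := orth_bound (Matrix.toBilin' (G.map (Int.cast : ℤ → ZMod p))) (by
      intro x y
      rw [Matrix.toBilin'_apply', Matrix.toBilin'_apply', dotProduct_comm, Matrix.dotProduct_mulVec,
      ← Matrix.mulVec_transpose, (show (G.map (Int.cast : ℤ → ZMod p)).transpose =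
        G.map (Int.cast : ℤ → ZMod p) by
        ext i j; simp [hs.apply i j]), dotProduct_comm, dotProduct_comm])
    (LinearMap.BilinForm.nondegenerate_toBilin'_iff_det_ne_zero.2 hd).1
    (LinearMap.range π) (LinearMap.range π) (by
      rintro _ ⟨c, rfl⟩ _ ⟨c', rfl⟩
      rw [Matrix.toBilin'_apply]
      simp only [hπ, Matrix.map_apply]
      have := congrArg (Int.cast : ℤ → ZMod p) (hint _ (lft c).2 _ (lft c').2)
      push_cast at this
      simpa using this)
  have hrk := LinearMap.finrank_range_add_finrank_ker π
  rw [Module.finrank_fintype_fun_eq_card] at hrk hS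
  by_contra ht
  have hker : LinearMap.ker π ≠ ⊥ := by
    intro h
    rw [h, finrank_bot] at hrk
    omega
  obtain ⟨c, hc, hc0⟩ := (Submodule.ne_bot_iff _).1 hker
  have hc1 : ∀ i, (p : ℤ) ∣ (lft c).1.1 i := fun i => by
    rw [← ZMod.intCast_zmod_eq_zero_iff_dvd, ← hπ]
    exact congrFun hc i
  choose a ha using hc1
  have h7 := hint _ (lft c).2 _ (lft c).2
  have h8 : (p : ℤ) * (∑ i, ((w i).val : ℤ) * ((lft c).1.2 i) ^ 2) = p * (p * ∑ i, ∑ j, a i * G i j * a j) := by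
    have e1 : ∑ i, ∑ j, (lft c).1.1 i * G i j * (lft c).1.1 j = p * (p * ∑ i, ∑ j, a i * G i j * a j) := by
      simp only [Finset.mul_sum]
      refine Finset.sum_congr rfl fun i _ => Finset.sum_congr rfl fun j _ => ?_
      rw [ha i, ha j]; ring
    rw [← e1, h7, Finset.mul_sum]
    refine Finset.sum_congr rfl fun i _ => ?_
    ring
  have h9 := mul_left_cancel₀ hp0 h8
  have h10 := congrArg (Int.cast : ℤ → ZMod p) h9
  push_cast at h10
  simp at h10
  have h11 := hw (fun i => ((lft c).1.2 i : ZMod p)) h10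
  apply hc0
  apply hinj
  apply Prod.ext
  · exact hc
  · rw [← hlft]; exact h11

end IEU

namespace IEU
open Module

noncomputable def fbr : ℤ → W := fun m => br (m : ℚ)

theorem fbr_witt : WittLike W fbr where
  sq a b ha hb := by
    have := br_sq (a := (a : ℚ)) (b := (b : ℚ)) (by exact_mod_cast ha) (by exact_mod_cast hb)
    simpa [fbr] using this
  neg a ha := by
    have := br_neg (a := (a : ℚ)) (by exact_mod_cast ha)
    simpa [fbr] using this
  add a b ha hb hab := by
    have := br_add (a := (a : ℚ)) (b := (b : ℚ)) (by exact_mod_cast ha) (by exact_mod_cast hb)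
      (by exact_mod_cast hab)
    simpa [fbr] using this

def PP (p : ℕ) (z : W) : Prop :=
  ∃ (ι : Type) (_ : Fintype ι) (_ : DecidableEq ι) (G : Matrix ι ι ℤ) (hs : G.IsSymm) (hd : G.det ≠ 0),
    (G.map (Int.cast : ℤ → ZMod p)).det ≠ 0 ∧ (Sp.ofZ G hs hd).cl = z

theorem PP_add_one (p : ℕ) [hp : Fact p.Prime] (z : W) (h : PP p z) (d : ℤ) (hd : Smooth p d) :
    PP p (z + fbr d) := by
  obtain ⟨ι, _, _, G, hs, hd', hdp, hz⟩ := h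
  obtain ⟨h1, h2, h3⟩ := Sp.ofZ_add G hs hd' d hd.1
  refine ⟨ι ⊕ Unit, inferInstance, inferInstance, _, h1, h2, ?_, ?_⟩
  · have : (Matrix.fromBlocks G 0 0 (Matrix.of (fun _ _ : Unit => d))).map (Int.cast : ℤ → ZMod p) =
      Matrix.fromBlocks (G.map (Int.cast : ℤ → ZMod p)) 0 0 (Matrix.of (fun _ _ : Unit => (d : ZMod p))) := by
      ext i j
      rcases i with i | i <;> rcases j with j | j <;> simp
    rw [this, det_blk]
    refine mul_ne_zero hdp ?_
    rw [Ne, ZMod.intCast_zmod_eq_zero_iff_dvd]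
    exact hd.not_dvd hp.1
  · rw [h3, hz]; rfl

theorem PP_add (p : ℕ) [hp : Fact p.Prime] (y : W) (hy : y ∈ Lk fbr p) :
    (∀ z, PP p z → PP p (z + y)) ∧ (∀ z, PP p z → PP p (z - y)) := by
  induction hy using AddSubgroup.closure_induction with
  | mem x hx =>
    obtain ⟨d, hd, rfl⟩ := hx
    refine ⟨fun z hz => PP_add_one p z hz d hd, fun z hz => ?_⟩
    rw [sub_eq_add_neg, ← fbr_witt.neg d hd.1]
    exact PP_add_one p z hz _ hd.neg
  | zero => simp
  | add x y _ _ hx hy =>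
    refine ⟨fun z hz => ?_, fun z hz => ?_⟩
    · rw [← add_assoc]; exact hy.1 _ (hx.1 _ hz)
    · rw [← sub_sub]; exact hy.2 _ (hx.2 _ hz)
  | neg x _ hx =>
    refine ⟨fun z hz => ?_, fun z hz => ?_⟩
    · rw [← sub_eq_add_neg]; exact hx.2 _ hz
    · rw [sub_neg_eq_add]; exact hx.1 _ hz

theorem descend_prime (p : ℕ) [hp : Fact p.Prime] (z : W) (hz : PP p z) (hz' : z ∈ Lk fbr (p + 1)) :
    z ∈ Lk fbr p := by
  obtain ⟨t, w, hw0, hw, hy⟩ := residue_form fbr_witt p hz'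
  have h1 := (PP_add p _ hy).2 z hz
  rw [sub_sub_cancel] at h1
  obtain ⟨ι, _, _, G, hs, hd, hdp, hG⟩ := h1
  have hne : ∀ i, ((p * ((w i).val : ℤ) : ℤ) : ℚ) ≠ 0 := by
    intro i
    have h1 : (w i).val ≠ 0 := by rw [Ne, ZMod.val_eq_zero]; exact hw0 i
    have h2 : (p : ℤ) * ((w i).val : ℤ) ≠ 0 := mul_ne_zero (by exact_mod_cast hp.1.ne_zero) (by exact_mod_cast h1)
    exact_mod_cast h2
  have h2 : (Sp.ofZ G hs hd).cl = (Sp.diag _ hne).cl := by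
    rw [hG, Sp.diag_cl]; rfl
  obtain ⟨I, hI, hdim⟩ := Sp.cl_eq.1 h2
  have ht : t = 0 := by
    refine residue_zero p G hs hdp t w hw I ?_ ?_
    · intro u hu v hv
      have := hI u hu v hv
      rwa [Sp.ofZ_B, Sp.diag_B] at this
    · have e1 : finrank ℚ (Sp.ofZ G hs hd).V = Fintype.card ι :=
        Module.finrank_fintype_fun_eq_card (R := ℚ) (η := ι)
      have e2 : finrank ℚ (Sp.diag _ hne).V = t := by
        have := Module.finrank_fintype_fun_eq_card (R := ℚ) (η := Fin t)
        rwa [Fintype.card_fin] at this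
      rw [e1, e2] at hdim
      exact hdim
  subst ht
  simpa using hy

theorem unimod_cl {n : ℕ} (G : Matrix (Fin n) (Fin n) ℤ) (hs : G.IsSymm) (hd : G.det ≠ 0)
    (hu : IsUnit G.det) : ∃ k : ℤ, (Sp.ofZ G hs hd).cl = k • fbr 1 := by
  set z := (Sp.ofZ G hs hd).cl with hz
  have key : ∀ K : ℕ, 2 ≤ K → z ∈ Lk fbr K → z ∈ Lk fbr 2 := by
    intro K hK
    induction K, hK using Nat.le_induction with
    | base => exact id
    | succ k hk ih =>
      intro h
      apply ih
      by_cases hp : k.Prime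
      · haveI : Fact k.Prime := ⟨hp⟩
        refine descend_prime k z ⟨Fin n, inferInstance, inferInstance, G, hs, hd, ?_, rfl⟩ h
        have h2 : (Int.castRingHom (ZMod k)).mapMatrix G = G.map (Int.cast : ℤ → ZMod k) := rfl
        rw [← h2, ← RingHom.map_det]
        exact (hu.map (Int.castRingHom (ZMod k))).ne_zero
      · exact Lk_notprime hp h
  obtain ⟨m, a, ha, hza⟩ := Sp.exists_diag (Sp.ofZ G hs hd)
  refine Lk_two fbr_witt (key (2 + ∑ i, (a i).natAbs) (by omega) ?_)
  rw [hz, hza]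
  refine AddSubgroup.sum_mem _ fun i _ => mem_Lk (f := fbr) (Smooth.of_lt (ha i) ?_)
  have := Finset.single_le_sum (f := fun i => (a i).natAbs) (fun _ _ => Nat.zero_le _) (Finset.mem_univ i)
  have h3 : |a i| = ((a i).natAbs : ℤ) := Int.abs_eq_natAbs _
  rw [h3]
  omega

/-- core of isotropy: from a relation with `m` copies of `e = ±1`. -/
theorem isotropic_rat {n : ℕ} (G : Matrix (Fin n) (Fin n) ℤ) (hs : G.IsSymm) (hd : G.det ≠ 0)
    (e : ℚ) (he : 0 < e ∨ e < 0) (m : ℕ)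
    (I : Submodule ℚ ((Fin n → ℚ) × (Fin m → ℚ)))
    (hI : ∀ u ∈ I, ∀ v ∈ I, ∑ i, ∑ j, u.1 i * (G i j : ℚ) * v.1 j = ∑ i, e * (u.2 i * v.2 i))
    (hdim : n + m ≤ 2 * finrank ℚ I)
    (y : Fin n → ℚ) (hy : e * (∑ i, ∑ j, y i * (G i j : ℚ) * y j) < 0) :
    ∃ v : Fin n → ℚ, v ≠ 0 ∧ ∑ i, ∑ j, v i * (G i j : ℚ) * v j = 0 := by
  have he2 : 0 < e * e := by rcases he with h | h <;> nlinarith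
  let g : (Fin m → ℚ) × ℚ →ₗ[ℚ] (Fin n → ℚ) × (Fin m → ℚ) :=
    LinearMap.prod ((LinearMap.toSpanSingleton ℚ _ y) ∘ₗ LinearMap.snd ℚ _ _) (LinearMap.fst ℚ _ _)
  have hg : ∀ x, g x = (x.2 • y, x.1) := fun x => rfl
  have hy0 : y ≠ 0 := by rintro rfl; simp at hy
  have hginj : Function.Injective g := by
    rintro ⟨a, b⟩ ⟨c, d⟩ h
    rw [hg, hg] at h
    simp only [Prod.mk.injEq] at h
    obtain ⟨h1, h2⟩ := h
    rw [smul_left_injective ℚ hy0 h1, h2]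
  have hgI : Disjoint (LinearMap.range g) I := by
    rw [Submodule.disjoint_def]
    rintro _ ⟨⟨a, b⟩, rfl⟩ hx
    have h1 := hI _ hx _ hx
    rw [hg] at h1
    simp only [Pi.smul_apply, smul_eq_mul] at h1
    have h2 : ∑ i, ∑ j, b * y i * (G i j : ℚ) * (b * y j) = b ^ 2 * ∑ i, ∑ j, y i * (G i j : ℚ) * y j := by
      simp only [Finset.mul_sum]
      refine Finset.sum_congr rfl fun i _ => Finset.sum_congr rfl fun j _ => ?_
      ring
    rw [h2, ← Finset.mul_sum] at h1
    have h3 : 0 ≤ ∑ i, a i * a i := Finset.sum_nonneg fun i _ => mul_self_nonneg _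
    have h4 : b ^ 2 * (e * ∑ i, ∑ j, y i * (G i j : ℚ) * y j) = (e * e) * ∑ i, a i * a i := by
      linear_combination e * h1
    have h5 : 0 ≤ (e * e) * ∑ i, a i * a i := mul_nonneg he2.le h3
    have hb : b = 0 := by
      by_contra hb
      have : 0 < b ^ 2 := by positivity
      nlinarith
    subst hb
    have h6 : ∑ i, a i * a i = 0 := by
      rw [zero_pow two_ne_zero, zero_mul] at h4
      rcases mul_eq_zero.1 h4.symm with h | h
      · exact absurd h he2.ne'
      · exact h
    have h7 : a = 0 := by
      rw [Finset.sum_eq_zero_iff_of_nonneg (fun i _ => mul_self_nonneg _)] at h6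
      funext i
      exact mul_self_eq_zero.1 (h6 i (Finset.mem_univ i))
    rw [hg, h7]; simp
  have d1 : finrank ℚ (LinearMap.range g) = m + 1 := by
    rw [LinearMap.finrank_range_of_inj hginj]
    simp
  have d2 := Submodule.finrank_add_le_finrank_add_finrank (LinearMap.range g) I
  have d3 := Submodule.finrank_sup_add_finrank_inf_eq (LinearMap.range g) I
  rw [hgI.eq_bot, finrank_bot] at d3
  have d4 := Submodule.finrank_le (LinearMap.range g ⊔ I)
  have d5 : finrank ℚ ((Fin n → ℚ) × (Fin m → ℚ)) = n + m := by simp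
  rw [d5] at d4
  let π : I →ₗ[ℚ] (Fin m → ℚ) := LinearMap.snd ℚ _ _ ∘ₗ I.subtype
  have d6 := LinearMap.finrank_range_add_finrank_ker π
  have d7 := Submodule.finrank_le (LinearMap.range π)
  rw [show finrank ℚ (Fin m → ℚ) = m by simp] at d7
  have hker : LinearMap.ker π ≠ ⊥ := by
    intro h
    rw [h, finrank_bot] at d6
    omega
  obtain ⟨⟨u, hu⟩, hc, hc0⟩ := (Submodule.ne_bot_iff _).1 hker
  have hu2 : u.2 = 0 := hc
  refine ⟨u.1, ?_, ?_⟩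
  · intro h
    apply hc0
    apply Subtype.ext
    exact Prod.ext h hu2
  · rw [hI u hu u hu, hu2]
    simp

theorem isotropy {n : ℕ} (G : Matrix (Fin n) (Fin n) ℤ) (hs : G.IsSymm) (hu : IsUnit G.det)
    (x y : Fin n → ℤ) (hx : 0 < ∑ i, ∑ j, x i * G i j * x j) (hy : ∑ i, ∑ j, y i * G i j * y j < 0) :
    ∃ v : Fin n → ℤ, v ≠ 0 ∧ ∑ i, ∑ j, v i * G i j * v j = 0 := by
  have hd : G.det ≠ 0 := hu.ne_zero
  obtain ⟨k, hk⟩ := unimod_cl G hs hd hu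
  have hrat : ∃ v : Fin n → ℚ, v ≠ 0 ∧ ∑ i, ∑ j, v i * (G i j : ℚ) * v j = 0 := by
    have hx' : 0 < ∑ i, ∑ j, (x i : ℚ) * (G i j : ℚ) * (x j : ℚ) := by exact_mod_cast hx
    have hy' : ∑ i, ∑ j, (y i : ℚ) * (G i j : ℚ) * (y j : ℚ) < 0 := by exact_mod_cast hy
    have main : ∀ (e : ℚ) (he : e ≠ 0) (hbe : k • fbr 1 = ∑ i : Fin k.natAbs, br e),
       (∃ z : Fin n → ℚ, e * (∑ i, ∑ j, z i * (G i j : ℚ) * z j) < 0) →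
        ∃ v : Fin n → ℚ, v ≠ 0 ∧ ∑ i, ∑ j, v i * (G i j : ℚ) * v j = 0 := by
      rintro e he hbe ⟨z, hz⟩
      have h2 : (Sp.ofZ G hs hd).cl = (Sp.diag (fun _ : Fin k.natAbs => e) (fun _ => he)).cl := by
        rw [hk, Sp.diag_cl, hbe]
      obtain ⟨I, hI, hdim⟩ := Sp.cl_eq.1 h2
      refine isotropic_rat G hs hd e (by rcases lt_or_gt_of_ne he with h | h <;> simp [h]) _ I ?_ ?_ z hz
      · intro u hu v hv
        have := hI u hu v hv
        rwa [Sp.ofZ_B, Sp.diag_B] at this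
      · have e1 : finrank ℚ (Sp.ofZ G hs hd).V = n := by
          have := Module.finrank_fintype_fun_eq_card (R := ℚ) (η := Fin n)
          rwa [Fintype.card_fin] at this
        have e2 : finrank ℚ (Sp.diag (fun _ : Fin k.natAbs => e) (fun _ => he)).V = k.natAbs := by
          have := Module.finrank_fintype_fun_eq_card (R := ℚ) (η := Fin k.natAbs)
          rwa [Fintype.card_fin] at this
        rw [e1, e2] at hdim
        exact hdim
    have hb1 : fbr 1 = br 1 := by simp [fbr]
    rcases le_total 0 k with h | h
    · refine main 1 one_ne_zero ?_ ⟨fun i => y i, by simpa using hy'⟩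
      rw [Finset.sum_const, Finset.card_univ, Fintype.card_fin, ← natCast_zsmul, Int.natAbs_of_nonneg h, hb1]
    · refine main (-1) (by norm_num) ?_ ⟨fun i => x i, by simpa using hx'⟩
      rw [Finset.sum_const, Finset.card_univ, Fintype.card_fin, ← natCast_zsmul,
        Int.ofNat_natAbs_of_nonpos h, hb1, br_neg one_ne_zero]
      simp
  obtain ⟨v, hv0, hv⟩ := hrat
  obtain ⟨N, hN, w, hw⟩ := clr v
  have hN' : (N : ℚ) ≠ 0 := by exact_mod_cast hN
  refine ⟨w, ?_, ?_⟩
  · rintro rfl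
    apply hv0
    funext i
    have := hw i
    simp [hN] at this
    exact this
  · have : ∑ i, ∑ j, (w i : ℚ) * (G i j : ℚ) * (w j : ℚ) = 0 := by
      simp only [hw]
      rw [← mul_zero ((N : ℚ) ^ 2), ← hv]
      simp only [Finset.mul_sum]
      refine Finset.sum_congr rfl fun i _ => Finset.sum_congr rfl fun j _ => ?_
      ring
    exact_mod_cast this
end IEU

namespace IEU
open Module

def Uni {E : Type} [AddCommGroup E] (B : LinearMap.BilinForm ℤ E) : Prop :=
  (∀ x y, B x y = B y x) ∧ (∀ z, (∀ w, B z w = 0) → z = 0) ∧ ∀ φ : E →ₗ[ℤ] ℤ, ∃ z, ∀ w, B z w = φ w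

theorem isotropy_abs {E : Type} [AddCommGroup E] [Module.Free ℤ E] [Module.Finite ℤ E]
    {B : LinearMap.BilinForm ℤ E} (hB : Uni B) (x y : E) (hx : 0 < B x x) (hy : B y y < 0) :
    ∃ v, v ≠ 0 ∧ B v v = 0 := by
  let b := Module.finBasis ℤ E
  have hbij : Function.Bijective B := by
    constructor
    · rw [injective_iff_map_eq_zero]
      intro z hz
      exact hB.2.1 z (fun w => by rw [hz]; rfl)
    · intro φ
      obtain ⟨z, hz⟩ := hB.2.2 φ
      exact ⟨z, LinearMap.ext hz⟩
  let G : Matrix (Fin (finrank ℤ E)) (Fin (finrank ℤ E)) ℤ := Matrix.of fun i j => B (b i) (b j)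
  have hG : ∀ i j, G i j = B (b i) (b j) := fun i j => rfl
  have hq : ∀ x : Fin (finrank ℤ E) → ℤ, ∑ i, ∑ j, x i * G i j * x j = B (b.equivFun.symm x) (b.equivFun.symm x) := by
    intro x
    simp only [Basis.equivFun_symm_apply, map_sum, LinearMap.sum_apply, map_smul, LinearMap.smul_apply, smul_eq_mul, hG]
    rw [Finset.sum_comm]
    refine Finset.sum_congr rfl fun i _ => ?_
    rw [Finset.mul_sum]
    refine Finset.sum_congr rfl fun j _ => ?_
    ring
  have hu : IsUnit G.det := by
    have h1 := LinearEquiv.isUnit_det (LinearEquiv.ofBijective B hbij) b b.dualBasis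
    have h2 : LinearMap.toMatrix b b.dualBasis (LinearEquiv.ofBijective B hbij : E →ₗ[ℤ] Dual ℤ E) = G := by
      ext i j
      rw [LinearMap.toMatrix_apply, Basis.dualBasis_repr, hG, hB.1]
      rfl
    rwa [h2] at h1
  obtain ⟨v, hv0, hv⟩ := isotropy G (by ext i j; exact hB.1 _ _) hu (b.equivFun x) (b.equivFun y)
    (by rw [hq, LinearEquiv.symm_apply_apply]; exact hx) (by rw [hq, LinearEquiv.symm_apply_apply]; exact hy)
  refine ⟨b.equivFun.symm v, ?_, ?_⟩
  · rw [Ne, LinearEquiv.map_eq_zero_iff]; exact hv0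
  · rw [← hq, hv]

theorem divide {E : Type} [AddCommGroup E] {B : LinearMap.BilinForm ℤ E} (hB : Uni B) (v : E) (d : ℤ)
    (hd : d ≠ 0) (h : ∀ y, d ∣ B v y) : ∃ x, v = d • x := by
  let φ : E →ₗ[ℤ] ℤ :=
    { toFun := fun y => B v y / d
      map_add' := by
        intro y z
        rw [map_add, Int.add_ediv_of_dvd_left (h y)]
      map_smul' := by
        intro m y
        simp only [map_smul, smul_eq_mul, RingHom.id_apply]
        rw [Int.mul_ediv_assoc _ (h y)] }
  obtain ⟨x, hx⟩ := hB.2.2 φ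
  refine ⟨x, ?_⟩
  rw [← sub_eq_zero]
  apply hB.2.1
  intro w
  simp only [map_sub, map_smul, LinearMap.sub_apply, LinearMap.smul_apply, smul_eq_mul, hx]
  show B v w - d * (B v w / d) = 0
  rw [Int.mul_ediv_cancel' (h w), sub_self]

theorem prim {E : Type} [AddCommGroup E] {B : LinearMap.BilinForm ℤ E} (hB : Uni B) (v : E)
    (hv : v ≠ 0) (hvv : B v v = 0) : ∃ x y, B x x = 0 ∧ B x y = 1 := by
  obtain ⟨d, hd⟩ := (IsPrincipalIdealRing.principal (LinearMap.range (B v))).principal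
  have hdv : ∀ y, d ∣ B v y := by
    intro y
    have : B v y ∈ LinearMap.range (B v) := ⟨y, rfl⟩
    rw [hd] at this
    exact Ideal.mem_span_singleton.1 this
  have hd0 : d ≠ 0 := by
    rintro rfl
    exact hv (hB.2.1 v fun w => zero_dvd_iff.1 (hdv w))
  obtain ⟨x, rfl⟩ := divide hB v d hd0 hdv
  have : d ∈ LinearMap.range (B (d • x)) := by rw [hd]; exact Submodule.mem_span_singleton_self d
  obtain ⟨y, hy⟩ := this
  simp only [map_smul, LinearMap.smul_apply, smul_eq_mul] at hy hvv
  refine ⟨x, y, ?_, ?_⟩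
  · simpa [hd0] using hvv
  · exact mul_left_cancel₀ hd0 (by rw [hy, mul_one])

theorem uni_perp {E : Type} [AddCommGroup E] {B : LinearMap.BilinForm ℤ E} (hB : Uni B) (e : E) (ε : ℤ)
    (hε : ε * ε = 1) (he : B e e = ε) : Uni (B.restrict (LinearMap.ker (B e))) := by
  let π : E →ₗ[ℤ] LinearMap.ker (B e) :=
    LinearMap.codRestrict _ (LinearMap.id - ε • (B e).smulRight e) (by
      intro z
      rw [LinearMap.mem_ker]
      simp only [LinearMap.sub_apply, LinearMap.id_apply, LinearMap.smul_apply, LinearMap.smulRight_apply,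
        map_sub, map_smul, smul_eq_mul, he]
      linear_combination (-(B e z)) * hε)
  have hπ : ∀ z, (π z : E) = z - (ε * B e z) • e := by
    intro z
    simp [π, mul_smul, smul_comm ε]
  have hn : ∀ n : LinearMap.ker (B e), B e n = 0 := fun n => n.2
  have hz : ∀ z (n : LinearMap.ker (B e)), B z n = B (π z) n := by
    intro z n
    rw [hπ]
    simp [hn]
  refine ⟨fun x y => hB.1 _ _, ?_, ?_⟩
  · intro z h
    apply Subtype.ext
    apply hB.2.1
    intro w
    rw [hB.1, hz, hB.1]
    exact h (π w)
  · intro φ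
    obtain ⟨w, hw⟩ := hB.2.2 (φ ∘ₗ π)
    refine ⟨π w, fun n => ?_⟩
    show B (π w) n = _
    rw [← hz, hw]
    show φ (π n) = _
    congr 1
    apply Subtype.ext
    rw [hπ, hn]; simp

theorem rank_perp {E : Type} [AddCommGroup E] [Module.Free ℤ E] [Module.Finite ℤ E] {B : LinearMap.BilinForm ℤ E} (e : E) (ε : ℤ)
    (hε : ε * ε = 1) (he : B e e = ε) : finrank ℤ (LinearMap.ker (B e)) < finrank ℤ E := by
  let g : ℤ × LinearMap.ker (B e) →ₗ[ℤ] E :=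
    LinearMap.coprod (LinearMap.toSpanSingleton ℤ E e) (LinearMap.ker (B e)).subtype
  have hg : Function.Injective g := by
    rw [injective_iff_map_eq_zero]
    rintro ⟨a, n⟩ h
    have h0 : a • e + (n : E) = 0 := h
    have h1 := congrArg (B e) h0
    have hn : B e n = 0 := n.2
    simp only [map_add, map_smul, hn, he, smul_eq_mul, map_zero, add_zero] at h1
    have ha : a = 0 := by linear_combination ε * h1 - a * hε
    subst ha
    simp at h0
    simp [h0]
  have := LinearMap.finrank_le_finrank_of_injective hg
  simp at this
  omega

def Diag {E : Type} [AddCommGroup E] (B : LinearMap.BilinForm ℤ E) : Prop :=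
  ∃ (ι : Type) (_ : Fintype ι) (v : ι → E) (ε : ι → ℤ), (∀ i, ε i * ε i = 1) ∧
    (∀ i, B (v i) (v i) = ε i) ∧ (∀ i j, i ≠ j → B (v i) (v j) = 0) ∧ ∀ z, (∀ i, B (v i) z = 0) → z = 0

theorem diag_extend {E : Type} [AddCommGroup E] {B : LinearMap.BilinForm ℤ E} (hB : Uni B) (e : E) (ε : ℤ)
    (hε : ε * ε = 1) (he : B e e = ε) (h : Diag (B.restrict (LinearMap.ker (B e)))) : Diag B := by
  obtain ⟨ι, _, v, η, h1, h2, h3, h4⟩ := h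
  have hn : ∀ n : LinearMap.ker (B e), B e n = 0 := fun n => n.2
  refine ⟨Option ι, inferInstance, fun o => o.elim e (fun i => v i), fun o => o.elim ε η, ?_, ?_, ?_, ?_⟩
  · rintro (_ | i)
    · exact hε
    · exact h1 i
  · rintro (_ | i)
    · exact he
    · exact h2 i
  · rintro (_ | i) (_ | j) hij
    · exact absurd rfl hij
    · exact hn _
    · show B (v i) e = 0
      rw [hB.1]; exact hn _
    · exact h3 i j (fun h => hij (by rw [h]))
  · intro z hz
    have hz0 : z ∈ LinearMap.ker (B e) := hz none
    have := h4 ⟨z, hz0⟩ (fun i => hz (some i))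
    exact congrArg Subtype.val this

theorem odd_diag (n : ℕ) : ∀ (E : Type) [AddCommGroup E] [Module.Free ℤ E] [Module.Finite ℤ E]
    (B : LinearMap.BilinForm ℤ E), Uni B → finrank ℤ E = n → (∃ t, Odd (B t t)) → (∃ x, 0 < B x x) →
    (∃ y, B y y < 0) → Diag B := by
  induction n using Nat.strong_induction_on with
  | _ n ih =>
  intro E _ _ _ B hB hn ⟨t, ht⟩ ⟨x0, hx0⟩ ⟨y0, hy0⟩
  obtain ⟨v, hv, hvv⟩ := isotropy_abs hB x0 y0 hx0 hy0
  obtain ⟨x, y, hxx, hxy⟩ := prim hB v hv hvv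
  have hyx : B y x = 1 := by rw [hB.1, hxy]
  obtain ⟨y, hxy, hyy⟩ : ∃ y, B x y = 1 ∧ Odd (B y y) := by
    rcases Int.even_or_odd (B y y) with h | h
    · refine ⟨t + (1 - B x t) • y, ?_, ?_⟩
      · simp [hxy]
      · have : B (t + (1 - B x t) • y) (t + (1 - B x t) • y) =
          B t t + 2 * ((1 - B x t) * B t y) + (1 - B x t) ^ 2 * B y y := by
          simp only [map_add, map_smul, LinearMap.add_apply, LinearMap.smul_apply, smul_eq_mul, hB.1 y t]
          ring
        rw [this]
        exact (ht.add_even (even_two_mul _)).add_even (h.mul_left _)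
    · exact ⟨y, hxy, h⟩
  obtain ⟨m, hm⟩ := hyy
  have hyx : B y x = 1 := by rw [hB.1, hxy]
  let e1 := y - m • x
  let e2 := y - (m + 1) • x
  have h11 : B e1 e1 = 1 := by
    simp only [e1, map_sub, map_smul, LinearMap.sub_apply, LinearMap.smul_apply, smul_eq_mul, hxx, hxy, hyx, hm]
    ring
  have h22 : B e2 e2 = -1 := by
    simp only [e2, map_sub, map_smul, LinearMap.sub_apply, LinearMap.smul_apply, smul_eq_mul, hxx, hxy, hyx, hm]
    ring
  have h12 : B e1 e2 = 0 := by
    simp only [e1, e2, map_sub, map_smul, LinearMap.sub_apply, LinearMap.smul_apply, smul_eq_mul, hxx, hxy, hyx, hm]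
    ring
  have h21 : B e2 e1 = 0 := by rw [hB.1, h12]
  by_cases c1 : ∃ z, B e1 z = 0 ∧ 0 < B z z
  · obtain ⟨z, hz, hzz⟩ := c1
    refine diag_extend hB e1 1 (by norm_num) h11 ?_
    refine ih _ (hn ▸ rank_perp e1 1 (by norm_num) h11) _ _ (uni_perp hB e1 1 (by norm_num) h11) rfl ?_ ?_ ?_
    · exact ⟨⟨e2, h12⟩, by show Odd (B e2 e2); rw [h22]; decide⟩
    · exact ⟨⟨z, hz⟩, hzz⟩
    · exact ⟨⟨e2, h12⟩, by show B e2 e2 < 0; rw [h22]; decide⟩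
  by_cases c2 : ∃ z, B e2 z = 0 ∧ B z z < 0
  · obtain ⟨z, hz, hzz⟩ := c2
    refine diag_extend hB e2 (-1) (by norm_num) h22 ?_
    refine ih _ (hn ▸ rank_perp e2 (-1) (by norm_num) h22) _ _ (uni_perp hB e2 (-1) (by norm_num) h22) rfl ?_ ?_ ?_
    · exact ⟨⟨e1, h21⟩, by show Odd (B e1 e1); rw [h11]; decide⟩
    · exact ⟨⟨e1, h21⟩, by show 0 < B e1 e1; rw [h11]; decide⟩
    · exact ⟨⟨z, hz⟩, hzz⟩
  push Not at c1 c2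
  have hq : ∀ z, B e1 z = 0 → B e2 z = 0 → B z z = 0 := fun z h1 h2 => le_antisymm (c1 z h1) (c2 z h2)
  refine ⟨Bool, inferInstance, fun b => if b then e1 else e2, fun b => if b then 1 else -1, ?_, ?_, ?_, ?_⟩
  · rintro (_ | _) <;> simp
  · rintro (_ | _) <;> simp [h11, h22]
  · rintro (_ | _) (_ | _) <;> simp [h12, h21]
  · intro z hz
    have hz1 : B e1 z = 0 := hz true
    have hz2 : B e2 z = 0 := hz false
    apply hB.2.1
    intro w
    let w' := w - (B e1 w) • e1 + (B e2 w) • e2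
    have hw1 : B e1 w' = 0 := by simp [w', h11, h12]
    have hw2 : B e2 w' = 0 := by simp [w', h22, h21]
    have h1 := hq (z + w') (by rw [map_add, hz1, hw1, add_zero]) (by rw [map_add, hz2, hw2, add_zero])
    have h2 := hq z hz1 hz2
    have h3 := hq w' hw1 hw2
    simp only [map_add, LinearMap.add_apply, h2, h3, hB.1 w' z] at h1
    have h4 : B z w' = B z w := by
      simp [w', hB.1 z e1, hB.1 z e2, hz1, hz2]
    rw [h4] at h1
    omega

end IEU

namespace IEU
open Module

structure Hyp {E : Type} [AddCommGroup E] (B : LinearMap.BilinForm ℤ E) (x y : E) : Prop where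
  uni : Uni B
  even : ∀ z, Even (B z z)
  xx : B x x = 0
  yy : B y y = 0
  xy : B x y = 1

theorem Hyp.yx {E : Type} [AddCommGroup E] {B : LinearMap.BilinForm ℤ E} {x y : E} (h : Hyp B x y) :
    B y x = 1 := by rw [h.uni.1, h.xy]

theorem exists_hyp {E : Type} [AddCommGroup E] [Module.Free ℤ E] [Module.Finite ℤ E]
    {B : LinearMap.BilinForm ℤ E} (hB : Uni B) (he : ∀ z, Even (B z z))
    (x y : E) (hx : 0 < B x x) (hy : B y y < 0) : ∃ x y, Hyp B x y := by
  obtain ⟨v, hv, hvv⟩ := isotropy_abs hB x y hx hy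
  obtain ⟨x, y, hxx, hxy⟩ := prim hB v hv hvv
  obtain ⟨m, hm⟩ := he y
  have hyx : B y x = 1 := by rw [hB.1, hxy]
  refine ⟨x, y - m • x, hB, he, hxx, ?_, ?_⟩
  · simp only [map_sub, map_smul, LinearMap.sub_apply, LinearMap.smul_apply, smul_eq_mul, hxx, hxy, hyx, hm]
    ring
  · simp [hxx, hxy]

def nb {E : Type} [AddCommGroup E] (B : LinearMap.BilinForm ℤ E) (x y : E) : LinearMap.BilinForm ℤ E :=
  LinearMap.mk₂ ℤ (fun z w => B z w - B z y * B w x - B z x * B w y + B z y * B w y - B z x * B w x)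
    (by intro a b c; simp only [map_add, LinearMap.add_apply]; ring)
    (by intro a b c; simp only [map_smul, LinearMap.smul_apply, smul_eq_mul]; ring)
    (by intro a b c; simp only [map_add, LinearMap.add_apply]; ring)
    (by intro a b c; simp only [map_smul, LinearMap.smul_apply, smul_eq_mul]; ring)

theorem nb_apply {E : Type} [AddCommGroup E] (B : LinearMap.BilinForm ℤ E) (x y z w : E) :
   nb B x y z w = B z w - B z y * B w x - B z x * B w y + B z y * B w y - B z x * B w x := rfl

/-- multiply by two plus a combination of `x`, `y`. -/
def tw {E : Type} [AddCommGroup E] (B : LinearMap.BilinForm ℤ E) (x y : E) (a b c d : ℤ) : E →ₗ[ℤ] E :=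
  (2 : ℤ) • LinearMap.id + (a • B.flip y + b • B.flip x).smulRight x + (c • B.flip y + d • B.flip x).smulRight y

theorem tw_apply {E : Type} [AddCommGroup E] (B : LinearMap.BilinForm ℤ E) (x y : E) (a b c d : ℤ) (z : E) :
    tw B x y a b c d z = (2 : ℤ) • z + (a * B z y + b * B z x) • x + (c * B z y + d * B z x) • y := by
  simp only [tw, LinearMap.add_apply, LinearMap.smul_apply, LinearMap.id_apply, LinearMap.smulRight_apply,
    smul_eq_mul]
  rfl

section
variable {E : Type} [AddCommGroup E] {B : LinearMap.BilinForm ℤ E} {x y : E}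

theorem nb_uni (h : Hyp B x y) : Uni (nb B x y) := by
  have hxx := h.xx
  have hyy := h.yy
  have hxy := h.xy
  have hyx := h.yx
  refine ⟨?_, ?_, ?_⟩
  · intro z w
    rw [nb_apply, nb_apply, h.uni.1 z w]; ring
  · intro z hz
    have h1 := hz x
    have h2 := hz y
    rw [nb_apply] at h1 h2
    simp only [hxx, hxy, hyx, hyy] at h1 h2
    apply h.uni.2.1
    intro w
    have h3 := hz w
    rw [nb_apply] at h3
    have e1 : B z y = 0 := by linarith
    have e2 : B z x = 0 := by linarith
    rw [e1, e2] at h3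
    linarith
  · intro φ
    obtain ⟨u, hu⟩ := h.uni.2.2 φ
    refine ⟨u + (B u x - B u y) • x - (B u x + B u y) • y, fun w => ?_⟩
    rw [nb_apply, ← hu]
    simp only [map_sub, map_add, map_smul, LinearMap.sub_apply, LinearMap.add_apply, LinearMap.smul_apply, smul_eq_mul, hxx, hxy, hyx, hyy,
      h.uni.1 x w, h.uni.1 y w]
    ring

def jj (B : LinearMap.BilinForm ℤ E) (x y : E) : E →ₗ[ℤ] E := tw B x y (-1) 2 1 (-4)
def kk (B : LinearMap.BilinForm ℤ E) (x y : E) : E →ₗ[ℤ] E := tw B x y 0 2 1 (-3)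

theorem jj_form (h : Hyp B x y) (z w : E) : nb B x y (jj B x y z) (jj B x y w) = 4 * B z w := by
  rw [nb_apply, jj, tw_apply, tw_apply]
  simp only [map_sub, map_add, map_smul, LinearMap.sub_apply, LinearMap.add_apply, LinearMap.smul_apply, smul_eq_mul, h.xx, h.xy, h.yx, h.yy,
      h.uni.1 x w, h.uni.1 y w]
  ring

theorem kk_form (h : Hyp B x y) (z w : E) : B (kk B x y z) (kk B x y w) = 4 * nb B x y z w := by
  rw [nb_apply, kk, tw_apply, tw_apply]
  simp only [map_sub, map_add, map_smul, LinearMap.sub_apply, LinearMap.add_apply, LinearMap.smul_apply, smul_eq_mul, h.xx, h.xy, h.yx, h.yy,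
      h.uni.1 x w, h.uni.1 y w]
  ring

theorem jj_inj (h : Hyp B x y) : Function.Injective (jj B x y) := by
  rw [injective_iff_map_eq_zero]
  intro z hz
  apply h.uni.2.1
  intro w
  have := jj_form h z w
  rw [hz] at this
  simp at this
  exact this

theorem nb_char (h : Hyp B x y) (z : E) : Even (nb B x y z z - nb B x y z (x + y)) := by
  rw [map_add, nb_apply, nb_apply, nb_apply]
  simp only [h.xx, h.xy, h.yx, h.yy]
  obtain ⟨m, hm⟩ := h.even z
  obtain ⟨a, ha⟩ := Int.even_mul_succ_self (B z y)
  obtain ⟨b, hb⟩ := Int.even_mul_succ_self (B z x)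
  rw [hm]
  refine ⟨m - B z y * B z x + a - b - B z y + B z x, ?_⟩
  linear_combination ha - hb

theorem jj_range (h : Hyp B x y) (v : E) : (∃ z, jj B x y z = v) ↔
    ∃ (u : E) (k : ℤ), Even (nb B x y u u) ∧ v = (2 : ℤ) • u + k • (x + y) := by
  constructor
  · rintro ⟨z, rfl⟩
    refine ⟨z - (B z y) • x - (B z x) • y + (B z x) • x - (B z x) • y, B z y, ?_, ?_⟩
    · obtain ⟨m, hm⟩ := h.even z
      rw [nb_apply]
      simp only [map_sub, map_add, map_smul, LinearMap.sub_apply, LinearMap.add_apply, LinearMap.smul_apply, smul_eq_mul, h.xx, h.xy, h.yx, h.yy,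
        h.uni.1 x z, h.uni.1 y z, hm]
      refine ⟨m - B z y * B z x, ?_⟩
      ring
    · rw [jj, tw_apply]
      module
  · rintro ⟨u, k, hu, rfl⟩
    have hc := nb_char h u
    have h1 : Even (nb B x y u (x + y)) := by
      have := hu.sub hc
      simpa using this
    rw [map_add, nb_apply, nb_apply] at h1
    simp only [h.xx, h.xy, h.yx, h.yy] at h1
    obtain ⟨m, hm⟩ := h1
    have hm' : B u y = B u x + 2 * m := by linarith
    refine ⟨u - (B u y) • x - (B u x) • y + (B u x + B u y + k) • x + m • y, ?_⟩
    rw [jj, tw_apply]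
    simp only [map_sub, map_add, map_smul, LinearMap.sub_apply, LinearMap.add_apply, LinearMap.smul_apply, smul_eq_mul, h.xx, h.xy, h.yx, h.yy, hm']
    module

theorem nb_diag [Module.Free ℤ E] [Module.Finite ℤ E] (h : Hyp B x y) : Diag (nb B x y) := by
  refine odd_diag _ E _ (nb_uni h) rfl ⟨x, ?_⟩ ⟨x, ?_⟩ ⟨y, ?_⟩ <;> rw [nb_apply] <;>
    simp [h.xx, h.xy, h.yx, h.yy]

end

section
variable {E F : Type} [AddCommGroup E] [AddCommGroup F] {B : LinearMap.BilinForm ℤ E} {x y : E}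
  {C : LinearMap.BilinForm ℤ F} {a b : F}

theorem glue_half (h : Hyp B x y) (h' : Hyp C a b) (φ : E ≃ₗ[ℤ] F)
    (hφ : ∀ z w, nb C a b (φ z) (φ w) = nb B x y z w) (w : F) (hw : φ (x + y) = (a + b) + (2 : ℤ) • w)
    (hw2 : Even (nb C a b w w)) (z : E) : ∃ z', jj C a b z' = φ (jj B x y z) := by
  obtain ⟨u, k, hu, hz⟩ := (jj_range h _).1 ⟨z, rfl⟩
  rw [jj_range h']
  refine ⟨φ u + k • w, k, ?_, ?_⟩
  · simp only [map_add, map_smul, LinearMap.add_apply, LinearMap.smul_apply, smul_eq_mul, hφ, (nb_uni h').1 w (φ u)]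
    obtain ⟨m, hm⟩ := hu
    obtain ⟨n, hn⟩ := hw2
    rw [hm, hn]
    exact ⟨m + k * (nb C a b (φ u) w) + k * k * n, by ring⟩
  · rw [hz, map_add, map_smul, map_smul, hw]
    module

theorem glue (h : Hyp B x y) (h' : Hyp C a b) (φ : E ≃ₗ[ℤ] F)
    (hφ : ∀ z w, nb C a b (φ z) (φ w) = nb B x y z w) (w : F) (hw : φ (x + y) = (a + b) + (2 : ℤ) • w)
    (hw2 : Even (nb C a b w w)) : ∃ e : E ≃ₗ[ℤ] F, ∀ z w, C (e z) (e w) = B z w := by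
  have H1 := glue_half h h' φ hφ w hw hw2
  have hφ' : ∀ z w, nb B x y (φ.symm z) (φ.symm w) = nb C a b z w := by
    intro z w
    rw [← hφ]; simp
  have H2 := glue_half h' h φ.symm hφ' (-(φ.symm w)) (by
    have : φ.symm (φ (x + y)) = φ.symm (a + b) + (2 : ℤ) • φ.symm w := by rw [hw, map_add, map_smul]
    rw [LinearEquiv.symm_apply_apply] at this
    rw [this]; module) (by
      simp only [map_neg, LinearMap.neg_apply, neg_neg, hφ']
      exact hw2)
  let J := LinearEquiv.ofInjective (jj C a b) (jj_inj h')
  let f : E →ₗ[ℤ] F := J.symm.toLinearMap ∘ₗ LinearMap.codRestrict (LinearMap.range (jj C a b))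
    (φ.toLinearMap ∘ₗ jj B x y) (fun z => H1 z)
  have hf : ∀ z, jj C a b (f z) = φ (jj B x y z) := by
    intro z
    have : J (f z) = LinearMap.codRestrict (LinearMap.range (jj C a b))
      (φ.toLinearMap ∘ₗ jj B x y) (fun z => H1 z) z := J.apply_symm_apply _
    exact congrArg Subtype.val this
  have hfb : Function.Bijective f := by
    constructor
    · intro z w hzw
      apply jj_inj h
      apply φ.injective
      rw [← hf, ← hf, hzw]
    · intro z'
      obtain ⟨z, hz⟩ := H2 z'
      refine ⟨z, jj_inj h' ?_⟩
      rw [hf, hz, LinearEquiv.apply_symm_apply]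
  refine ⟨LinearEquiv.ofBijective f hfb, fun z w => ?_⟩
  show C (f z) (f w) = _
  have h1 := jj_form h' (f z) (f w)
  rw [hf, hf, hφ, jj_form h] at h1
  linarith

/-- reflection in `b`. -/
theorem refl_exists (h' : Hyp C a b) : ∃ ρ : F ≃ₗ[ℤ] F, (∀ z w, nb C a b (ρ z) (ρ w) = nb C a b z w) ∧
    ρ a = a ∧ ρ b = - b := by
  have hN := (nb_uni h').1
  have hbb : nb C a b b b = -1 := by
    rw [nb_apply]; simp [h'.xx, h'.xy, h'.yx, h'.yy]
  have hba : nb C a b b a = 0 := by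
    rw [nb_apply]; simp [h'.xx, h'.xy, h'.yx, h'.yy]
  let r : F →ₗ[ℤ] F := LinearMap.id + (2 : ℤ) • (nb C a b b).smulRight b
  have hr : ∀ z, r z = z + (2 * nb C a b b z) • b := by
    intro z; simp [r]; module
  have hrr : r ∘ₗ r = LinearMap.id := by
    ext z
    simp only [LinearMap.comp_apply, hr, map_add, map_smul, hbb, LinearMap.id_apply, smul_eq_mul]
    module
  refine ⟨LinearEquiv.ofLinearMap r r hrr hrr, ?_, ?_, ?_⟩
  · intro z w
    simp only [LinearEquiv.coe_ofLinearMap, hr, map_add, map_smul, LinearMap.add_apply, LinearMap.smul_apply, smul_eq_mul, hbb, hN z b]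
    ring
  · simp [hr, hba]
  · simp only [LinearEquiv.coe_ofLinearMap, hr, hbb]
    module

theorem glue_all (h : Hyp B x y) (h' : Hyp C a b) (φ : E ≃ₗ[ℤ] F)
    (hφ : ∀ z w, nb C a b (φ z) (φ w) = nb B x y z w) : ∃ e : E ≃ₗ[ℤ] F, ∀ z w, C (e z) (e w) = B z w := by
  have hN := (nb_uni h').1
  obtain ⟨w, hw⟩ : ∃ w, φ (x + y) - (a + b) = (2 : ℤ) • w := by
    refine divide (nb_uni h') _ 2 two_ne_zero ?_
    intro z
    have h1 := nb_char h (φ.symm z)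
    have h2 := nb_char h' z
    rw [← hφ, ← hφ, LinearEquiv.apply_symm_apply] at h1
    have h3 := h2.sub h1
    rw [hN, map_sub]
    have e : nb C a b z z - nb C a b z (a + b) - (nb C a b z z - nb C a b z (φ (x + y))) =
       nb C a b z (φ (x + y)) - nb C a b z (a + b) := by ring
    rw [e] at h3
    exact h3.two_dvd
  have hw : φ (x + y) = (a + b) + (2 : ℤ) • w := by rw [← hw]; abel
  rcases Int.even_or_odd (nb C a b w w) with hw2 | hw2
  · exact glue h h' φ hφ w hw hw2
  · obtain ⟨ρ, hρ, ha, hb⟩ := refl_exists h'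
    refine glue h h' (φ.trans ρ) (fun z w => by simp [hρ, hφ]) (ρ w - b) ?_ ?_
    · rw [LinearEquiv.trans_apply, hw, map_add, map_add, map_smul, ha, hb]
      module
    · have hbb : nb C a b b b = -1 := by
        rw [nb_apply]; simp [h'.xx, h'.xy, h'.yx, h'.yy]
      simp only [map_sub, LinearMap.sub_apply, hρ, hbb, hN b (ρ w)]
      obtain ⟨m, hm⟩ := hw2
      rw [hm]
      exact ⟨m - nb C a b (ρ w) b, by ring⟩

end

/-- coordinates from a diagonal family -/
theorem diag_coord {E : Type} [AddCommGroup E] {B : LinearMap.BilinForm ℤ E}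
    {ι : Type} [Fintype ι] (v : ι → E) (ε : ι → ℤ) (h1 : ∀ i, ε i * ε i = 1)
    (h2 : ∀ i, B (v i) (v i) = ε i) (h3 : ∀ i j, i ≠ j → B (v i) (v j) = 0)
    (h4 : ∀ z, (∀ i, B (v i) z = 0) → z = 0) :
    ∃ e : E ≃ₗ[ℤ] (ι → ℤ), ∀ z w, B z w = ∑ i, ε i * (e z i * e w i) := by
  classical
  let g : E →ₗ[ℤ] (ι → ℤ) := LinearMap.pi (fun i => B (v i))
  have hg : ∀ z i, g z i = B (v i) z := fun z i => rfl
  have hs : ∀ (c : ι → ℤ) i, B (v i) (∑ j, (ε j * c j) • v j) = c i := by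
    intro c i
    rw [map_sum, Finset.sum_eq_single i]
    · rw [map_smul, h2, smul_eq_mul]; linear_combination c i * h1 i
    · intro j _ hj
      rw [map_smul, h3 i j (Ne.symm hj), smul_zero]
    · simp
  have hb : Function.Bijective g := by
    constructor
    · rw [injective_iff_map_eq_zero]
      intro z hz
      exact h4 z (fun i => congrFun hz i)
    · intro c
      exact ⟨∑ j, (ε j * c j) • v j, funext fun i => hs c i⟩
  refine ⟨LinearEquiv.ofBijective g hb, fun z w => ?_⟩
  show _ = ∑ i, ε i * (g z i * g w i)
  have hz : z = ∑ j, (ε j * g z j) • v j := by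
    apply hb.1
    funext i
    rw [hg _ i, hg _ i, hs]
    rfl
  conv_lhs => rw [hz]
  simp only [map_sum, LinearMap.sum_apply, map_smul, LinearMap.smul_apply, smul_eq_mul]
  refine Finset.sum_congr rfl fun i _ => ?_
  rw [hg w]; ring

/-- the counts -/
def HasCount {E : Type} [AddCommGroup E] (B : LinearMap.BilinForm ℤ E) (p q : ℕ) : Prop :=
  ∃ (ι : Type) (_ : Fintype ι) (e : E ≃ₗ[ℤ] (ι → ℤ)) (ε : ι → ℤ), (∀ i, ε i * ε i = 1) ∧
    (∀ z w, B z w = ∑ i, ε i * (e z i * e w i)) ∧ Nat.card {i // ε i = 1} = p ∧ Nat.card {i // ¬ ε i = 1} = q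

theorem iso_of_count {E F : Type} [AddCommGroup E] [AddCommGroup F] {B : LinearMap.BilinForm ℤ E}
    {C : LinearMap.BilinForm ℤ F} {p q : ℕ} (h : HasCount B p q) (h' : HasCount C p q) :
    ∃ φ : E ≃ₗ[ℤ] F, ∀ z w, C (φ z) (φ w) = B z w := by
  classical
  obtain ⟨ι, _, e, ε, h1, h2, h3, h4⟩ := h
  obtain ⟨κ, _, f, η, h1', h2', h3', h4'⟩ := h'
  have s1 : Nonempty ({i // ε i = 1} ≃ {i // η i = 1}) := by
    rw [← Finite.card_eq, h3, h3']
  have s2 : Nonempty ({i // ¬ ε i = 1} ≃ {i // ¬ η i = 1}) := by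
    rw [← Finite.card_eq, h4, h4']
  obtain ⟨s1⟩ := s1
  obtain ⟨s2⟩ := s2
  let σ : ι ≃ κ := (Equiv.sumCompl (fun i => ε i = 1)).symm.trans ((Equiv.sumCongr s1 s2).trans
    (Equiv.sumCompl (fun i => η i = 1)))
  have hm1 : ∀ i, ¬ ε i = 1 → ε i = -1 := fun i hi => by
    rcases mul_self_eq_one_iff.1 (h1 i) with h | h
    · exact absurd h hi
    · exact h
  have hm2 : ∀ i, ¬ η i = 1 → η i = -1 := fun i hi => by
    rcases mul_self_eq_one_iff.1 (h1' i) with h | h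
    · exact absurd h hi
    · exact h
  have hσ : ∀ i, η (σ i) = ε i := by
    intro i
    by_cases hi : ε i = 1
    · have : σ i = s1 ⟨i, hi⟩ := by
        have h0 := Equiv.sumCompl_symm_apply_of_pos (p := fun i => ε i = 1) hi
        simp only [σ, Equiv.trans_apply]
        rw [h0]
        rfl
      rw [this, hi]
      exact (s1 ⟨i, hi⟩).2
    · have : σ i = s2 ⟨i, hi⟩ := by
        have h0 := Equiv.sumCompl_symm_apply_of_neg (p := fun i => ε i = 1) hi
        simp only [σ, Equiv.trans_apply]
        rw [h0]
        rfl
      rw [this, hm1 i hi]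
      exact hm2 _ (s2 ⟨i, hi⟩).2
  let φ : E ≃ₗ[ℤ] F := e.trans ((LinearEquiv.funCongrLeft ℤ ℤ σ.symm).trans f.symm)
  have hφ : ∀ z i, f (φ z) (σ i) = e z i := by
    intro z i
    simp [φ, LinearEquiv.funCongrLeft_apply, LinearMap.funLeft_apply]
  refine ⟨φ, fun z w => ?_⟩
  rw [h2, h2', ← Equiv.sum_comp σ]
  simp only [hφ, hσ]

end IEU

namespace IEU
open Module

theorem sig_lemma {n : ℕ} (C : LinearMap.BilinForm ℝ (Fin n → ℝ)) {ι : Type} [Fintype ι]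
    (u : ι → Fin n → ℝ) (δ : ι → ℝ) (P : ι → Prop) (hP : ∀ i, P i → 0 < δ i) (hN : ∀ i, ¬ P i → δ i < 0)
    (h : ∀ i, C (u i) (u i) = δ i) (ho : ∀ i j, i ≠ j → C (u i) (u j) = 0) (hn : n ≤ Fintype.card ι) :
    sSup {d : ℕ | ∃ W : Submodule ℝ (Fin n → ℝ), Module.finrank ℝ W = d ∧
      ∀ x ∈ W, x ≠ 0 → 0 < C x x} = Nat.card {i // P i} := by
  classical
  have hδ : ∀ i, δ i ≠ 0 := fun i => by
    by_cases hi : P i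
    · exact (hP i hi).ne'
    · exact (hN i hi).ne
  have hform : ∀ (κ : Type) [Fintype κ] (f : κ → ι) (hf : Function.Injective f) (c : κ → ℝ),
      C (∑ k, c k • u (f k)) (∑ k, c k • u (f k)) = ∑ k, δ (f k) * c k ^ 2 := by
    intro κ _ f hf c
    simp only [map_sum, LinearMap.sum_apply, map_smul, LinearMap.smul_apply, smul_eq_mul]
    refine Finset.sum_congr rfl fun i _ => ?_
    rw [Finset.sum_eq_single i]
    · rw [h]; ring
    · intro j _ hj
      rw [ho _ _ (fun e => hj (hf e))]; ring
    · simp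
  have hli : LinearIndependent ℝ u := by
    rw [Fintype.linearIndependent_iff]
    intro g hg i
    have h1 := congrArg (C (u i)) hg
    rw [map_sum, Finset.sum_eq_single i] at h1
    · simpa [h, hδ] using h1
    · intro j _ hj
      rw [map_smul, ho i j (Ne.symm hj), smul_zero]
    · simp
  have hspan : ∀ Q : ι → Prop, finrank ℝ (Submodule.span ℝ (Set.range fun i : {i // Q i} => u i)) = Nat.card {i // Q i} := by
    intro Q
    rw [Nat.card_eq_fintype_card]
    exact finrank_span_eq_card (hli.comp _ Subtype.val_injective)
  apply IsGreatest.csSup_eq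
  constructor
  · refine ⟨_, hspan P, ?_⟩
    intro x hx hx0
    obtain ⟨c, rfl⟩ := (Submodule.mem_span_range_iff_exists_fun ℝ).1 hx
    rw [hform _ Subtype.val Subtype.val_injective]
    have hc : ∃ i, c i ≠ 0 := by
      by_contra hc
      push Not at hc
      exact hx0 (by simp [hc])
    obtain ⟨i, hi⟩ := hc
    refine Finset.sum_pos' (fun j _ => mul_nonneg (hP j j.2).le (sq_nonneg _)) ⟨i, Finset.mem_univ i, ?_⟩
    have := hP i i.2
    positivity
  · rintro d ⟨W, rfl, hW⟩
    have hdis : Disjoint W (Submodule.span ℝ (Set.range fun i : {i // ¬ P i} => u i)) := by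
      rw [Submodule.disjoint_def]
      intro x hxW hx
      by_contra hx0
      have h1 := hW x hxW hx0
      obtain ⟨c, rfl⟩ := (Submodule.mem_span_range_iff_exists_fun ℝ).1 hx
      rw [hform _ Subtype.val Subtype.val_injective] at h1
      have : ∑ k : {i // ¬ P i}, δ k * c k ^ 2 ≤ 0 :=
        Finset.sum_nonpos fun j _ => mul_nonpos_of_nonpos_of_nonneg (hN j j.2).le (sq_nonneg _)
      linarith
    have d3 := Submodule.finrank_sup_add_finrank_inf_eq W (Submodule.span ℝ (Set.range fun i : {i // ¬ P i} => u i))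
    rw [hdis.eq_bot, finrank_bot, hspan] at d3
    have d4 := Submodule.finrank_le (W ⊔ (Submodule.span ℝ (Set.range fun i : {i // ¬ P i} => u i)))
    rw [Module.finrank_fin_fun] at d4
    have d5 := Fintype.card_congr (Equiv.sumCompl P)
    rw [Fintype.card_sum] at d5
    rw [Nat.card_eq_fintype_card] at d3 ⊢
    omega

noncomputable def bR (L : EvenLattice) (R : Type) [CommRing R] : LinearMap.BilinForm R (Fin L.n → R) :=
  Matrix.toBilin' (L.B.map (Int.cast : ℤ → R))

theorem bR_apply (L : EvenLattice) (R : Type) [CommRing R] (x y : Fin L.n → R) :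
    bR L R x y = formR L R x y := by
  rw [bR, Matrix.toBilin'_apply, formR]
  refine Finset.sum_congr rfl fun i _ => Finset.sum_congr rfl fun j _ => ?_
  rw [Matrix.map_apply]; ring

theorem form_symm (L : EvenLattice) (R : Type) [CommRing R] (x y : Fin L.n → R) :
    formR L R x y = formR L R y x := by
  rw [formR, formR, Finset.sum_comm]
  refine Finset.sum_congr rfl fun i _ => Finset.sum_congr rfl fun j _ => ?_
  rw [L.symm.apply i j]; ring

theorem form_cast (L : EvenLattice) (R : Type) [CommRing R] (x y : Fin L.n → ℤ) :
    formR L R (fun i => (x i : R)) (fun i => (y i : R)) = ((formR L ℤ x y : ℤ) : R) := by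
  simp [formR]

theorem form_mulVec (L : EvenLattice) (R : Type) [CommRing R] (x y : Fin L.n → R) :
    formR L R x y = ∑ j, ((L.B.map (Int.cast : ℤ → R)).mulVec x) j * y j := by
  rw [form_symm, formR]
  simp only [Matrix.mulVec, dotProduct, Matrix.map_apply, Finset.sum_mul]
  refine Finset.sum_congr rfl fun i _ => Finset.sum_congr rfl fun j _ => ?_
  ring

theorem bZ_uni (L : EvenLattice) (hL : dualSub L = intSub L) : Uni (bR L ℤ) := by
  classical
  have hdet : IsUnit (L.B.map (Int.cast : ℤ → ℚ)).det := by
    have := (Int.castRingHom ℚ).map_det L.B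
    have h2 : (Int.castRingHom ℚ).mapMatrix L.B = L.B.map (Int.cast : ℤ → ℚ) := rfl
    rw [h2] at this
    rw [← this, isUnit_iff_ne_zero]
    simpa using L.nondeg
  refine ⟨fun x y => by rw [bR_apply, bR_apply, form_symm], ?_, ?_⟩
  · intro z hz
    have hm : L.B.map (Int.cast : ℤ → ℤ) = L.B := by ext; simp
    have := (LinearMap.BilinForm.nondegenerate_toBilin'_iff_det_ne_zero.2 L.nondeg).1
    rw [bR, hm] at hz
    exact this z hz
  · intro φ
    let a : Fin L.n → ℚ := fun i => (φ (Pi.single i 1) : ℚ)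
    let x : Fin L.n → ℚ := (L.B.map (Int.cast : ℤ → ℚ))⁻¹.mulVec a
    have hx : (L.B.map (Int.cast : ℤ → ℚ)).mulVec x = a := by
      simp only [x, Matrix.mulVec_mulVec]
      rw [Matrix.mul_nonsing_inv _ hdet, Matrix.one_mulVec]
    have hxd : x ∈ dualSub L := by
      intro y hy
      choose m hm using hy
      refine ⟨∑ j, φ (Pi.single j 1) * m j, ?_⟩
      rw [form_mulVec, hx]
      push_cast
      refine Finset.sum_congr rfl fun j _ => ?_
      rw [hm j]
    rw [hL] at hxd
    choose z hz using hxd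
    refine ⟨z, fun w => ?_⟩
    have hz' : x = fun i => (z i : ℚ) := funext hz
    have h1 : ((formR L ℤ z w : ℤ) : ℚ) = ((φ w : ℤ) : ℚ) := by
      rw [← form_cast, ← hz', form_mulVec, hx]
      have : w = ∑ j, w j • (Pi.single j 1 : Fin L.n → ℤ) := by
        ext i; simp [Finset.sum_apply, Pi.single_apply]
      conv_rhs => rw [this]
      simp only [map_sum, map_smul, smul_eq_mul]
      push_cast
      refine Finset.sum_congr rfl fun j _ => ?_
      simp only [a]; ring
    rw [bR_apply]
    exact_mod_cast h1

theorem bZ_even (L : EvenLattice) (z : Fin L.n → ℤ) : Even (bR L ℤ z z) := by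
  classical
  have hs : ∀ x y, bR L ℤ x y = bR L ℤ y x := fun x y => by rw [bR_apply, bR_apply, form_symm]
  have hz : z ∈ Submodule.span ℤ (Set.range (Pi.basisFun ℤ (Fin L.n))) := by
    rw [Basis.span_eq]; trivial
  induction hz using Submodule.span_induction with
  | mem x hx =>
    obtain ⟨i, rfl⟩ := hx
    have : bR L ℤ (Pi.basisFun ℤ (Fin L.n) i) (Pi.basisFun ℤ (Fin L.n) i) = L.B i i := by
      rw [bR, Pi.basisFun_apply, Matrix.toBilin'_single]
      simp
    rw [this]
    exact (even_iff_two_dvd).2 (L.even_diag i)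
  | zero => simp
  | add x y _ _ hx hy =>
    simp only [map_add, LinearMap.add_apply, hs y x]
    obtain ⟨a, ha⟩ := hx
    obtain ⟨b, hb⟩ := hy
    rw [ha, hb]
    exact ⟨a + b + bR L ℤ x y, by ring⟩
  | smul c x _ hx =>
    simp only [map_smul, LinearMap.smul_apply, smul_eq_mul]
    exact (hx.mul_left _).mul_left _

theorem exists_of_sSup {n : ℕ} (p : (Fin n → ℝ) → Prop)
    (h : 1 ≤ sSup {d : ℕ | ∃ W : Submodule ℝ (Fin n → ℝ), Module.finrank ℝ W = d ∧
      ∀ x ∈ W, x ≠ 0 → p x}) : ∃ x, p x := by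
  by_contra hp
  push Not at hp
  have : sSup {d : ℕ | ∃ W : Submodule ℝ (Fin n → ℝ), Module.finrank ℝ W = d ∧
      ∀ x ∈ W, x ≠ 0 → p x} ≤ 0 := by
    apply csSup_le'
    rintro d ⟨W, rfl, hW⟩
    have : W = ⊥ := by
      rw [Submodule.eq_bot_iff]
      intro x hx
      by_contra hx0
      exact hp x (hW x hx hx0)
    rw [this, finrank_bot]
  omega

theorem int_vec (L : EvenLattice) (s : ℤ) (x : Fin L.n → ℝ) (hx : 0 < s * formR L ℝ x x) :
    ∃ z : Fin L.n → ℤ, 0 < s * bR L ℤ z z := by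
  have hc : Continuous fun x : Fin L.n → ℝ => (s : ℝ) * formR L ℝ x x := by
    unfold formR
    fun_prop
  have ho : IsOpen {x : Fin L.n → ℝ | 0 < (s : ℝ) * formR L ℝ x x} := isOpen_lt continuous_const hc
  have hd : DenseRange (Pi.map (fun _ : Fin L.n => (Rat.cast : ℚ → ℝ))) :=
    DenseRange.piMap fun _ => Rat.denseRange_cast
  obtain ⟨q, hq⟩ := hd.exists_mem_open ho ⟨x, hx⟩
  obtain ⟨N, hN, z, hz⟩ := clr q
  refine ⟨z, ?_⟩
  have h1 : (fun i => ((z i : ℤ) : ℝ)) = (N : ℝ) • (Pi.map (fun _ : Fin L.n => (Rat.cast : ℚ → ℝ)) q) := by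
    funext i
    have := congrArg (Rat.cast : ℚ → ℝ) (hz i)
    push_cast at this
    simpa using this
  have h2 : ((s * formR L ℤ z z : ℤ) : ℝ) = (N : ℝ) ^ 2 * (s * formR L ℝ (Pi.map (fun _ : Fin L.n => (Rat.cast : ℚ → ℝ)) q) (Pi.map (fun _ : Fin L.n => (Rat.cast : ℚ → ℝ)) q)) := by
    push_cast
    rw [← form_cast, h1, ← bR_apply, ← bR_apply]
    simp only [map_smul, LinearMap.smul_apply, smul_eq_mul]
    ring
  have hN' : (0 : ℝ) < (N : ℝ) ^ 2 := by
    have : (N : ℝ) ≠ 0 := by exact_mod_cast hN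
    positivity
  have h3 : (0 : ℝ) < ((s * formR L ℤ z z : ℤ) : ℝ) := by
    rw [h2]; exact mul_pos hN' hq
  rw [bR_apply]
  exact_mod_cast h3

theorem lattice_main (L : EvenLattice) (hL : dualSub L = intSub L) (hr : 1 ≤ sigPlus L) (hs : 1 ≤ sigMinus L) :
    ∃ a b, Hyp (bR L ℤ) a b ∧ HasCount (nb (bR L ℤ) a b) (sigPlus L) (sigMinus L) := by
  have hU := bZ_uni L hL
  obtain ⟨x, hx⟩ := exists_of_sSup _ hr
  obtain ⟨y, hy⟩ := exists_of_sSup _ hs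
  obtain ⟨x', hx'⟩ := int_vec L 1 x (by simpa using hx)
  obtain ⟨y', hy'⟩ := int_vec L (-1) y (by simpa using hy)
  obtain ⟨a, b, hab⟩ := exists_hyp hU (bZ_even L) x' y' (by linarith) (by linarith)
  refine ⟨a, b, hab, ?_⟩
  obtain ⟨ι, _, v, ε, h1, h2, h3, h4⟩ := nb_diag hab
  obtain ⟨e, he⟩ := diag_coord v ε h1 h2 h3 h4
  have hcard : L.n = Fintype.card ι := by
    have := e.finrank_eq
    rwa [Module.finrank_fin_fun, Module.finrank_fintype_fun_eq_card] at this
  have hm1 : ∀ i, ¬ ε i = 1 → ε i = -1 := fun i hi => by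
    rcases mul_self_eq_one_iff.1 (h1 i) with h | h
    · exact absurd h hi
    · exact h
  let u : ι → Fin L.n → ℝ := fun i k => ((kk (bR L ℤ) a b (v i) k : ℤ) : ℝ)
  have hu : ∀ i j, bR L ℝ (u i) (u j) = ((4 * nb (bR L ℤ) a b (v i) (v j) : ℤ) : ℝ) := by
    intro i j
    rw [← kk_form hab, bR_apply, bR_apply, ← form_cast]
  refine ⟨ι, inferInstance, e, ε, h1, he, ?_, ?_⟩
  · rw [sigPlus]
    simp only [← bR_apply]
    symm
    refine sig_lemma (bR L ℝ) u (fun i => 4 * ε i) (fun i => ε i = 1) ?_ ?_ ?_ ?_ hcard.le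
    · intro i hi; simp [hi]
    · intro i hi; simp [hm1 i hi]
    · intro i; rw [hu, h2]; push_cast; rfl
    · intro i j hij; rw [hu, h3 i j hij]; simp
  · rw [sigMinus]
    simp only [← bR_apply]
    symm
    have := sig_lemma (-bR L ℝ) u (fun i => - (4 * ε i)) (fun i => ¬ ε i = 1) ?_ ?_ ?_ ?_ hcard.le
    · simpa only [LinearMap.neg_apply, neg_pos] using this
    · intro i hi; simp [hm1 i hi]
    · intro i hi; simp [not_not.1 hi]
    · intro i; rw [LinearMap.neg_apply, LinearMap.neg_apply, hu, h2]; push_cast; rfl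
    · intro i j hij; rw [LinearMap.neg_apply, LinearMap.neg_apply, hu, h3 i j hij]; simp

end IEU

/-- **Uniqueness of indefinite even unimodular lattices.** Two even unimodular lattices
(`L = L^*`) with equal signatures `(r, s)`, where `min(r,s) ≥ 1`, are isometric. -/
theorem indefinite_even_unimodular_unique
    (L M : EvenLattice) (hL : dualSub L = intSub L) (hM : dualSub M = intSub M)
    (hplus : sigPlus L = sigPlus M) (hminus : sigMinus L = sigMinus M)
    (hr : 1 ≤ sigPlus L) (hs : 1 ≤ sigMinus L) :
    IsometricOver ℤ L M := by
  obtain ⟨a, b, h, hc⟩ := IEU.lattice_main L hL hr hs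
  obtain ⟨a', b', h', hc'⟩ := IEU.lattice_main M hM (hplus ▸ hr) (hminus ▸ hs)
  rw [← hplus, ← hminus] at hc'
  obtain ⟨φ, hφ⟩ := IEU.iso_of_count hc hc'
  obtain ⟨e, he⟩ := IEU.glue_all h h' φ hφ
  refine ⟨e, fun x y => ?_⟩
  rw [← IEU.bR_apply, ← IEU.bR_apply, he]
end
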